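/- Let p be a prime number, m ∈ ℤ with m ≢ 0 mod p, A := ℤ[u_2,u_3,y], f := y^p − u_2 u_3^p − (m + u_3^p) p^p, R := A localized at the maximal ideal (p,u_2,u_3,y), and z := y − (m + u_3)p. Then (z,p,u_2,u_3) is a regular system of parameters of R, and the set of vertices of Δ(f;p,u_2,u_3;z) ⊆ ℝ³_{≥0} (coordinates ordered as exponents of p, u_2, u_3) is {(0,1/p,1), (1+1/p,0,0)} if m^p − m ≢ 0 mod p², and {(0,1/p,1), (1+1/(p−1),0,0), (1+1/p,0,1/p)} if m^p − m ≡ 0 mod p²; moreover in both cases Δ(f;p,u_2,u_3;z) = Δ(f;p,u_2,u_3), the characteristic polyhedron. -/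

import Mathlib

/-!
Characteristic polyhedra of singularities without completion
(V. Cossart, O. Piltant), formalized statements.
-/

noncomputable section

open IsLocalRing TensorProduct

namespace CharPolyhedra

universe u v

/-! ### Polyhedral notions -/

/-- The nonnegative orthant in `ℝ^d`. -/
def orthant (d : ℕ) : Set (Fin d → ℝ) := {x | ∀ i, 0 ≤ x i}

/-- An `F`-subset of `ℝ_{≥0}^d`: a closed convex subset stable under translation
by the nonnegative orthant. -/
def IsFSubset {d : ℕ} (Δ : Set (Fin d → ℝ)) : Prop :=
  Δ ⊆ orthant d ∧ IsClosed Δ ∧ Convex ℝ Δ ∧ ∀ v ∈ Δ, ∀ w ∈ orthant d, v + w ∈ Δ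

/-- The smallest `F`-subset containing a given set of points. -/
def smallestFSubset {d : ℕ} (X : Set (Fin d → ℝ)) : Set (Fin d → ℝ) :=
  ⋂₀ {Δ | IsFSubset Δ ∧ X ⊆ Δ}

/-- A vertex of an `F`-subset: a point cut out by a positive linear form. -/
def IsVertex {d : ℕ} (Δ : Set (Fin d → ℝ)) (v : Fin d → ℝ) : Prop :=
  ∃ L : Fin d → ℝ, (∀ i, 0 < L i) ∧ Δ ∩ {x | ∑ i, L i * x i = 1} = {v}

/-- A rational polyhedron: an `F`-subset cut out by finitely many nonnegative
rational linear forms. -/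
def IsRationalPolyhedron {d : ℕ} (Δ : Set (Fin d → ℝ)) : Prop :=
  ∃ (n : ℕ) (L : Fin n → Fin d → ℚ), (∀ j i, 0 ≤ L j i) ∧
    Δ = {x | x ∈ orthant d ∧ ∀ j, 1 ≤ ∑ i, (L j i : ℝ) * x i}

/-- `min {L(a) : a ∈ Δ}` for a linear form with rational coefficients `L`. -/
def ellOf {d : ℕ} (L : Fin d → ℚ) (Δ : Set (Fin d → ℝ)) : ℝ :=
  sInf ((fun x => ∑ i, (L i : ℝ) * x i) '' Δ)

/-! ### Regular local rings, systems of parameters -/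

/-- A family `s` of `n` elements is a regular system of parameters of the local
ring `R`: it generates the maximal ideal and `n` equals the Krull dimension. -/
def IsSysOfParams (R : Type u) [CommRing R] [IsLocalRing R] {n : ℕ} (s : Fin n → R) : Prop :=
  Ideal.span (Set.range s) = maximalIdeal R ∧ ringKrullDim R = n

/-- `(y, u 0, ..., u (d-1))` is a regular system of parameters of `R`. -/
def IsRSP (R : Type u) [CommRing R] [IsLocalRing R] {d : ℕ} (y : R) (u : Fin d → R) : Prop :=
  IsSysOfParams R (Fin.cons y u)

/-- A regular local ring: a Noetherian local ring whose maximal ideal is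
generated by a regular system of parameters. -/
def IsRegularLocalRing (R : Type u) [CommRing R] [IsLocalRing R] : Prop :=
  IsNoetherianRing R ∧ ∃ (n : ℕ) (s : Fin n → R), IsSysOfParams R s

/-- A regular ring: a Noetherian ring all of whose localizations at primes are
regular local rings. -/
def IsRegularRing (A : Type u) [CommRing A] : Prop :=
  IsNoetherianRing A ∧ ∀ (P : Ideal A) [P.IsPrime],
    IsRegularLocalRing (Localization.AtPrime P)

/-! ### Monomial expansions and polyhedra -/

variable {R : Type u} [CommRing R]

/-- The monomial `y^b u^a`, where `ab = (a, b)`. -/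
def monomial {d : ℕ} (y : R) (u : Fin d → R) (ab : (Fin d → ℕ) × ℕ) : R :=
  y ^ ab.2 * ∏ i, u i ^ ab.1 i

/-- A finite expansion `f = Σ_{(a,b)} C_{a,b} y^b u^a` with all coefficients units. -/
def IsUnitExpansion {d : ℕ} (f y : R) (u : Fin d → R)
    (c : ((Fin d → ℕ) × ℕ) →₀ R) : Prop :=
  (∀ ab ∈ c.support, IsUnit (c ab)) ∧ f = c.sum fun ab r => r * monomial y u ab

/-- The projection `(a, b) ↦ a / (m - b)` from the point `(0, m)`. -/
def projPoint {d : ℕ} (m : ℕ) (ab : (Fin d → ℕ) × ℕ) : Fin d → ℝ :=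
  fun i => (ab.1 i : ℝ) / ((m : ℝ) - (ab.2 : ℝ))

/-- The projected points attached to (the support of) an expansion. -/
def expPoints {d : ℕ} (m : ℕ) (s : Finset ((Fin d → ℕ) × ℕ)) : Set (Fin d → ℝ) :=
  {x | ∃ ab ∈ s, ab.2 < m ∧ x = projPoint m ab}

/-- The polyhedron `Δ(f; u; y)` computed with prescribed order `m`: the smallest
`F`-subset containing the projected supports of all finite unit-coefficient
expansions of `f` in the parameters `(y, u)`. -/
def DeltaOf {d : ℕ} (f y : R) (u : Fin d → R) (m : ℕ) : Set (Fin d → ℝ) :=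
  smallestFSubset (⋃ c ∈ {c | IsUnitExpansion f y u c}, expPoints m c.support)

/-- The order of the image of `f` in `R/(u_1, ..., u_d)`, i.e. the largest `n`
with `f ∈ M^n + (u_1, ..., u_d)`. -/
def ordRes {d : ℕ} [IsLocalRing R] (f : R) (u : Fin d → R) : ℕ :=
  sSup {n : ℕ | f ∈ (maximalIdeal R) ^ n ⊔ Ideal.span (Set.range u)}

/-- Hironaka's polyhedron `Δ(f; u_1, ..., u_d; y)`. -/
def Delta {d : ℕ} [IsLocalRing R] (f y : R) (u : Fin d → R) : Set (Fin d → ℝ) :=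
  DeltaOf f y u (ordRes f u)

/-! ### Completion and the characteristic polyhedron -/

/-- The `M`-adic completion `R̂` of a local ring `R`. -/
abbrev Completion (R : Type u) [CommRing R] [IsLocalRing R] : Type u :=
  AdicCompletion (maximalIdeal R) R

/-- The canonical map `R → R̂`. -/
def cmpl {R : Type u} [CommRing R] [IsLocalRing R] : R →+* Completion R :=
  algebraMap R (Completion R)

/-- `(ŷ, u_1, ..., u_d)` is a regular system of parameters of the completion
`R̂`: it generates the maximal ideal `M·R̂` of `R̂`. -/
def IsRSPhat (R : Type u) [CommRing R] [IsLocalRing R] {d : ℕ}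
    (yh : Completion R) (u : Fin d → R) : Prop :=
  Ideal.span (insert yh (Set.range fun i => cmpl (u i)))
    = (maximalIdeal R).map (cmpl (R := R))

/-- Hironaka's characteristic polyhedron `Δ(f; u_1, ..., u_d)`: the intersection
of the `Δ(f; u; ŷ)` over all regular systems of parameters `(ŷ, u_1, ..., u_d)`
of the completion `R̂`. -/
def CharPolyhedron {d : ℕ} [IsLocalRing R] (f : R) (u : Fin d → R) : Set (Fin d → ℝ) :=
  ⋂ yh ∈ {yh : Completion R | IsRSPhat R yh u},
    DeltaOf (cmpl f) yh (fun i => cmpl (u i)) (ordRes f u)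

/-! ### G-rings, excellence -/

/-- A `κ`-algebra `A` is geometrically regular if `κ' ⊗[κ] A` is a regular ring
for every finite field extension `κ'/κ`. -/
def IsGeometricallyRegularAlgebra (κ : Type u) [Field κ] (A : Type v) [CommRing A]
    [Algebra κ A] : Prop :=
  ∀ (κ' : Type u) [Field κ'] [Algebra κ κ'] [Module.Finite κ κ'],
    IsRegularRing (κ' ⊗[κ] A)

/-- A local ring has geometrically regular formal fibers if, for every prime
`P ⊂ R`, the formal fiber `κ(P) ⊗_R R̂` is a geometrically regular
`κ(P)`-algebra. -/
def HasGeomRegularFormalFibers (R : Type u) [CommRing R] [IsLocalRing R] : Prop :=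
  ∀ (P : Ideal R) [P.IsPrime],
    IsGeometricallyRegularAlgebra (ResidueField (Localization.AtPrime P))
      (ResidueField (Localization.AtPrime P) ⊗[R] Completion R)

/-- A G-ring: a Noetherian ring all of whose localizations at primes have
geometrically regular formal fibers. -/
def IsGRing (A : Type u) [CommRing A] : Prop :=
  IsNoetherianRing A ∧ ∀ (P : Ideal A) [P.IsPrime],
    HasGeomRegularFormalFibers (Localization.AtPrime P)

/-- A saturated chain of primes: each step is a covering relation. -/
def IsSaturatedChain {A : Type u} [CommRing A] (c : LTSeries (PrimeSpectrum A)) : Prop :=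
  ∀ i : Fin c.length, c.toFun i.castSucc ⋖ c.toFun i.succ

/-- A catenary ring: any two saturated chains of primes with the same endpoints
have the same length. -/
def IsCatenary (A : Type u) [CommRing A] : Prop :=
  ∀ (c₁ c₂ : LTSeries (PrimeSpectrum A)), c₁.head = c₂.head → c₁.last = c₂.last →
    IsSaturatedChain c₁ → IsSaturatedChain c₂ → c₁.length = c₂.length

/-- Universally catenary: all polynomial rings over `A` are catenary. -/
def IsUniversallyCatenary (A : Type u) [CommRing A] : Prop :=
  ∀ n : ℕ, IsCatenary (MvPolynomial (Fin n) A)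

/-- The regular locus of any domain finite over `A` is open. -/
def HasOpenRegularLocus (A : Type u) [CommRing A] : Prop :=
  ∀ (B : Type u) [CommRing B] [IsDomain B] [Algebra A B] [Module.Finite A B],
    IsOpen {P : PrimeSpectrum B | IsRegularLocalRing (Localization.AtPrime P.asIdeal)}

/-- Quasi-excellent: a G-ring with open regular loci for finite domains over it. -/
def IsQuasiExcellent (A : Type u) [CommRing A] : Prop :=
  IsGRing A ∧ HasOpenRegularLocus A

/-- Excellent: universally catenary and quasi-excellent. -/
def IsExcellent (A : Type u) [CommRing A] : Prop :=
  IsUniversallyCatenary A ∧ IsQuasiExcellent A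

/-! ### Monomial valuations and associated graded rings -/

/-- The weight `l·b + L(a)` of the monomial `y^b u^a`. -/
def weight {d : ℕ} (l : ℝ) (L : Fin d → ℝ) (ab : (Fin d → ℕ) × ℕ) : ℝ :=
  l * (ab.2 : ℝ) + ∑ i, L i * (ab.1 i : ℝ)

/-- The ideal `I_λ` generated by the monomials `y^b u^a` with `l·b + L(a) ≥ λ`. -/
def monIdeal {d : ℕ} (y : R) (u : Fin d → R) (l : ℝ) (L : Fin d → ℝ) (lam : ℝ) :
    Ideal R :=
  Ideal.span {g | ∃ ab : (Fin d → ℕ) × ℕ, g = monomial y u ab ∧ lam ≤ weight l L ab}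

/-- The monomial valuation `v(g) := max {λ : g ∈ I_λ}`. -/
def vval {d : ℕ} (y : R) (u : Fin d → R) (l : ℝ) (L : Fin d → ℝ) (g : R) : ℝ :=
  sSup {lam : ℝ | g ∈ monIdeal y u l L lam}

/-- The Rees algebra `⊕_λ I_λ` of the filtration `(I_λ)`, realized inside the
monoid algebra `R[ℝ]`. -/
def ReesAlgebra {d : ℕ} (y : R) (u : Fin d → R) (l : ℝ) (L : Fin d → ℝ) :
    Subalgebra R (AddMonoidAlgebra R ℝ) :=
  Algebra.adjoin R {p | ∃ (lam : ℝ) (x : R), x ∈ monIdeal y u l L lam ∧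
    p = AddMonoidAlgebra.single lam x}

/-- The ideal `⊕_λ I_{λ⁺}` of the Rees algebra. -/
def grIdeal {d : ℕ} (y : R) (u : Fin d → R) (l : ℝ) (L : Fin d → ℝ) :
    Ideal (ReesAlgebra y u l L) :=
  Ideal.span {p | ∃ (lam : ℝ) (x : R), (∃ lam' > lam, x ∈ monIdeal y u l L lam') ∧
    (p : AddMonoidAlgebra R ℝ) = AddMonoidAlgebra.single lam x}

/-- The associated graded ring `gr_v(R) = ⊕_λ I_λ / I_{λ⁺}` of `R` with respect
to the monomial valuation `v`, realized as `(⊕_λ I_λ) / (⊕_λ I_{λ⁺})`. -/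
abbrev GrRing {d : ℕ} (y : R) (u : Fin d → R) (l : ℝ) (L : Fin d → ℝ) : Type u :=
  ReesAlgebra y u l L ⧸ grIdeal y u l L

/-- `x ∈ gr_v(R)` is the initial form of `g ∈ R`: the class of `g` placed in
degree `v(g)`. -/
def IsInitialForm {d : ℕ} (y : R) (u : Fin d → R) (l : ℝ) (L : Fin d → ℝ) (g : R)
    (x : GrRing y u l L) : Prop :=
  ∃ h : AddMonoidAlgebra.single (vval y u l L g) g ∈ ReesAlgebra y u l L,
    x = Ideal.Quotient.mk (grIdeal y u l L)
      ⟨AddMonoidAlgebra.single (vval y u l L g) g, h⟩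

/-- The ideal generated by the `x_i^{s_i+1}`. -/
def NN {d : ℕ} (y : R) (u : Fin d → R) (s : (Fin d → ℕ) × ℕ) : Ideal R :=
  Ideal.span (insert (y ^ (s.2 + 1)) (Set.range fun i => u i ^ (s.1 i + 1)))

def Indep {d : ℕ} (y : R) (u : Fin d → R) : Prop :=
  ∀ s r, r * monomial y u s ∈ NN y u s → ¬ IsUnit r

def mdeg {d : ℕ} (s : (Fin d → ℕ) × ℕ) : ℕ := s.2 + ∑ i, s.1 i

lemma monomial_add {d : ℕ} (y : R) (u : Fin d → R) (s t : (Fin d → ℕ) × ℕ) :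
    monomial y u (s + t) = monomial y u s * monomial y u t := by
  simp only [monomial, Prod.snd_add, Prod.fst_add, Pi.add_apply, pow_add, Finset.prod_mul_distrib]
  ring

lemma mdeg_add {d : ℕ} (s t : (Fin d → ℕ) × ℕ) : mdeg (s + t) = mdeg s + mdeg t := by
  simp only [mdeg, Prod.snd_add, Prod.fst_add, Pi.add_apply, Finset.sum_add_distrib]
  ring

lemma mdeg_mono {d : ℕ} {s t : (Fin d → ℕ) × ℕ} (h : s ≤ t) : mdeg s ≤ mdeg t :=
  add_le_add h.2 (Finset.sum_le_sum fun i _ => h.1 i)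

lemma mdeg_sub {d : ℕ} {s t : (Fin d → ℕ) × ℕ} (h : s ≤ t) : s + (t - s) = t := by
  exact add_tsub_cancel_of_le h

lemma eq_of_le_of_mdeg {d : ℕ} {s t : (Fin d → ℕ) × ℕ} (h : s ≤ t) (h' : mdeg s = mdeg t) :
    s = t := by
  have h1 := mdeg_sub h
  have h2 : mdeg (t - s) = 0 := by
    have := mdeg_add s (t - s); rw [h1] at this; omega
  have h3 : t - s = 0 := by
    simp only [mdeg, Nat.add_eq_zero_iff, Finset.sum_eq_zero_iff] at h2
    ext i
    · exact h2.2 i (Finset.mem_univ i)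
    · exact h2.1
  rw [h3, add_zero] at h1; exact h1

lemma monomial_mem_NN {d : ℕ} (y : R) (u : Fin d → R) {s t : (Fin d → ℕ) × ℕ} (h : ¬ t ≤ s) :
    monomial y u t ∈ NN y u s := by
  have h' : s.2 + 1 ≤ t.2 ∨ ∃ i, s.1 i + 1 ≤ t.1 i := by
    by_contra hc
    push Not at hc
    exact h ⟨fun i => Nat.lt_succ_iff.1 (hc.2 i), Nat.lt_succ_iff.1 hc.1⟩
  rcases h' with h1 | ⟨i, hi⟩
  · refine Ideal.mul_mem_right _ _ (Ideal.mem_of_dvd _ (pow_dvd_pow y h1) ?_)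
    exact Ideal.subset_span (Set.mem_insert _ _)
  · refine Ideal.mul_mem_left _ _ (Ideal.mem_of_dvd _
      ((pow_dvd_pow (u i) hi).trans (Finset.dvd_prod_of_mem _ (Finset.mem_univ i))) ?_)
    exact Ideal.subset_span (Set.mem_insert_of_mem _ ⟨i, rfl⟩)

lemma mul_monomial_mem_NN {d : ℕ} (y : R) (u : Fin d → R) (s : (Fin d → ℕ) × ℕ) {r : R}
    (hr : r ∈ Ideal.span (insert y (Set.range u))) : r * monomial y u s ∈ NN y u s := by
  have : Ideal.span (insert y (Set.range u)) * Ideal.span {monomial y u s} ≤ NN y u s := by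
    rw [Ideal.span_mul_span, Ideal.span_le]
    rintro _ ⟨a, ha, b, rfl, rfl⟩
    rcases ha with rfl | ⟨i, rfl⟩
    · refine Ideal.mem_of_dvd (a := a ^ (s.2 + 1)) _ ?_ (Ideal.subset_span (Set.mem_insert _ _))
      exact ⟨∏ i, u i ^ s.1 i, by simp only [monomial]; ring⟩
    · refine Ideal.mem_of_dvd (a := u i ^ (s.1 i + 1)) _ ?_
        (Ideal.subset_span (Set.mem_insert_of_mem _ ⟨i, rfl⟩))
      have h2 : u i ^ s.1 i ∣ monomial y u s :=
        Dvd.dvd.mul_left (Finset.dvd_prod_of_mem (fun i => u i ^ s.1 i) (Finset.mem_univ i)) _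
      rw [pow_succ']
      exact mul_dvd_mul_left _ h2
  exact this (Ideal.mul_mem_mul hr (Ideal.mem_span_singleton_self _))

lemma monomial_mem_pow {d : ℕ} (y : R) (u : Fin d → R) (s : (Fin d → ℕ) × ℕ) :
    monomial y u s ∈ Ideal.span (insert y (Set.range u)) ^ mdeg s := by
  rw [mdeg, pow_add]
  refine Ideal.mul_mem_mul (Ideal.pow_mem_pow (Ideal.subset_span (Set.mem_insert _ _)) _) ?_
  rw [← Finset.prod_pow_eq_pow_sum]
  exact Ideal.prod_mem_prod fun i _ =>
    Ideal.pow_mem_pow (Ideal.subset_span (Set.mem_insert_of_mem _ (Set.mem_range_self i))) _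

lemma pow_le_span {d : ℕ} (y : R) (u : Fin d → R) (n : ℕ) :
    Ideal.span (insert y (Set.range u)) ^ n ≤
      Ideal.span (monomial y u '' {s | mdeg s = n}) := by
  induction n with
  | zero =>
    have : (1 : R) ∈ Ideal.span (monomial y u '' {s | mdeg s = 0}) :=
      Ideal.subset_span ⟨0, by simp [mdeg], by simp [monomial]⟩
    rw [(Ideal.eq_top_iff_one _).2 this]; exact le_top
  | succ n ih =>
    rw [pow_succ]
    refine (Ideal.mul_mono_left ih).trans ?_
    rw [Ideal.span_mul_span, Ideal.span_le]
    rintro _ ⟨_, ⟨s, hs, rfl⟩, b, hb, rfl⟩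
    have : ∃ t, mdeg t = 1 ∧ b = monomial y u t := by
      rcases hb with rfl | ⟨i, rfl⟩
      · exact ⟨(0, 1), by simp [mdeg], by simp [monomial]⟩
      · refine ⟨(Pi.single i 1, 0), by simp [mdeg], ?_⟩
        simp only [monomial, pow_zero, one_mul]
        rw [Finset.prod_eq_single i] <;> simp +contextual
    obtain ⟨t, ht, rfl⟩ := this
    refine Ideal.subset_span ⟨s + t, ?_, monomial_add _ _ _ _⟩
    have : mdeg s = n := hs
    change mdeg (s + t) = n + 1
    rw [mdeg_add]; omega

lemma pow_le_NN {d : ℕ} (y : R) (u : Fin d → R) (s : (Fin d → ℕ) × ℕ) {n : ℕ} (hn : mdeg s < n) :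
    Ideal.span (insert y (Set.range u)) ^ n ≤ NN y u s := by
  refine (pow_le_span y u n).trans ?_
  rw [Ideal.span_le]
  rintro _ ⟨t, ht, rfl⟩
  have ht' : mdeg t = n := ht
  exact monomial_mem_NN _ _ fun h => by have := mdeg_mono h; omega

lemma NN_anti {d : ℕ} (y : R) (u : Fin d → R) {s t : (Fin d → ℕ) × ℕ} (h : s ≤ t) :
    NN y u t ≤ NN y u s := by
  rw [NN, Ideal.span_le]
  rintro _ (rfl | ⟨i, rfl⟩)
  · exact Ideal.mem_of_dvd _ (pow_dvd_pow y (Nat.add_le_add_right h.2 1))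
      (Ideal.subset_span (Set.mem_insert _ _))
  · exact Ideal.mem_of_dvd _ (pow_dvd_pow (u i) (Nat.add_le_add_right (h.1 i) 1))
      (Ideal.subset_span (Set.mem_insert_of_mem _ ⟨i, rfl⟩))

lemma span_le_NN {d : ℕ} (y : R) (u : Fin d → R) (s : (Fin d → ℕ) × ℕ)
    (T : Set ((Fin d → ℕ) × ℕ)) (h : ∀ t ∈ T, ¬ t ≤ s) :
    Ideal.span (monomial y u '' T) ≤ NN y u s := by
  rw [Ideal.span_le]
  rintro _ ⟨t, ht, rfl⟩
  exact monomial_mem_NN _ _ (h t ht)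

lemma support_ge {d : ℕ} {f y : R} {u : Fin d → R} (hI : Indep y u)
    {c : ((Fin d → ℕ) × ℕ) →₀ R} (hc : IsUnitExpansion f y u c)
    (T : Set ((Fin d → ℕ) × ℕ)) (hf : f ∈ Ideal.span (monomial y u '' T))
    (s : (Fin d → ℕ) × ℕ) (hs : s ∈ c.support) : ∃ t ∈ T, t ≤ s := by
  by_contra hcon
  push Not at hcon
  obtain ⟨s', hs's, hmin⟩ := (c.support.finite_toSet).exists_le_minimal hs
  have h1 : f ∈ NN y u s' := span_le_NN y u s' T (fun t ht h => hcon t ht (h.trans hs's)) hf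
  refine hI s' (c s') ?_ (hc.1 s' hmin.1)
  have h2 := hc.2
  rw [Finsupp.sum, ← Finset.add_sum_erase _ _ hmin.1] at h2
  rw [h2] at h1
  refine (Ideal.add_mem_iff_left _ (Ideal.sum_mem _ fun t ht => ?_)).1 h1
  refine Ideal.mul_mem_left _ _ (monomial_mem_NN _ _ fun hle => ?_)
  rw [Finset.mem_erase] at ht
  exact ht.1 (le_antisymm hle (hmin.2 ht.2 hle))

lemma exists_support_le {d : ℕ} {f y : R} {u : Fin d → R}
    {c : ((Fin d → ℕ) × ℕ) →₀ R} (hc : IsUnitExpansion f y u c)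
    (s : (Fin d → ℕ) × ℕ) (hs : f ∉ NN y u s) : ∃ t ∈ c.support, t ≤ s := by
  by_contra hcon
  push Not at hcon
  apply hs
  rw [hc.2]
  exact Ideal.sum_mem _ fun t ht => Ideal.mul_mem_left _ _ (monomial_mem_NN _ _ (hcon t ht))
open Classical in
lemma expansion_step {d : ℕ} [IsLocalRing R] {f y : R} {u : Fin d → R}
    (hM : Ideal.span (insert y (Set.range u)) = maximalIdeal R) (hI : Indep y u)
    (T : Finset ((Fin d → ℕ) × ℕ)) (hT : ∀ t ∈ T, f ∉ NN y u t)
    (hT' : ∀ s, f ∉ NN y u s → ∃ t ∈ T, t ≤ s)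
    (K : ℕ) (hK : ∀ t ∈ T, mdeg t ≤ K) (n : ℕ) (r : (Fin d → ℕ) × ℕ → R)
    (hr : f - ∑ t ∈ T, r t * monomial y u t ∈ maximalIdeal R ^ n) :
    ∃ r' : (Fin d → ℕ) × ℕ → R, (∀ t, r' t - r t ∈ maximalIdeal R ^ (n - K)) ∧
      f - ∑ t ∈ T, r' t * monomial y u t ∈ maximalIdeal R ^ (n + 1) := by
  have h1 := pow_le_span y u n (by rw [hM]; exact hr)
  rw [Ideal.span, Finsupp.mem_span_image_iff_linearCombination] at h1
  obtain ⟨l, hl, hlr⟩ := h1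
  rw [Finsupp.linearCombination_apply, Finsupp.sum] at hlr
  simp only [smul_eq_mul] at hlr
  have hl' : ∀ s ∈ l.support, mdeg s = n := fun s hs => hl hs
  choose! τ hτ hτ' using hT'
  have hbad : ∀ s ∈ l.support, f ∈ NN y u s → l s * monomial y u s ∈ maximalIdeal R ^ (n + 1) := by
    intro s hs hfs
    have hmem : l s * monomial y u s ∈ NN y u s := by
      have h2 : f - ∑ t ∈ T, r t * monomial y u t ∈ NN y u s := by
        refine Ideal.sub_mem _ hfs (Ideal.sum_mem _ fun t ht => Ideal.mul_mem_left _ _ ?_)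
        exact monomial_mem_NN _ _ fun hle => hT t ht (NN_anti y u hle hfs)
      rw [← hlr, ← Finset.add_sum_erase _ _ hs] at h2
      refine (Ideal.add_mem_iff_left _ (Ideal.sum_mem _ fun t ht => ?_)).1 h2
      refine Ideal.mul_mem_left _ _ (monomial_mem_NN _ _ fun hle => ?_)
      rw [Finset.mem_erase] at ht
      exact ht.1 (eq_of_le_of_mdeg hle (by rw [hl' s hs, hl' t ht.2]))
    have h3 : l s ∈ maximalIdeal R := by
      rw [mem_maximalIdeal]; exact hI s _ hmem
    rw [pow_succ']
    refine Ideal.mul_mem_mul h3 ?_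
    rw [← hM, ← hl' s hs]; exact monomial_mem_pow _ _ _
  let G := l.support.filter fun s => f ∉ NN y u s
  refine ⟨fun t => r t + ∑ s ∈ G with τ s = t, l s * monomial y u (s - t), fun t => ?_, ?_⟩
  · simp only [add_sub_cancel_left]
    refine Ideal.sum_mem _ fun s hs => Ideal.mul_mem_left _ _ ?_
    simp only [G, Finset.mem_filter] at hs
    obtain ⟨⟨hs1, hs2⟩, rfl⟩ := hs
    have h4 := monomial_mem_pow y u (s - τ s)
    rw [hM] at h4
    refine Ideal.pow_le_pow_right ?_ h4
    have h5 := mdeg_add (τ s) (s - τ s)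
    rw [mdeg_sub (hτ' s hs2), hl' s hs1] at h5
    have := hK _ (hτ s hs2)
    omega
  · have h6 : ∑ t ∈ T, (∑ s ∈ G with τ s = t, l s * monomial y u (s - t)) * monomial y u t
        = ∑ s ∈ G, l s * monomial y u s := by
      rw [← Finset.sum_fiberwise_of_maps_to (s := G) (t := T) (g := τ)
        (fun s hs => hτ s (Finset.mem_filter.1 hs).2)]
      refine Finset.sum_congr rfl fun t ht => ?_
      rw [Finset.sum_mul]
      refine Finset.sum_congr rfl fun s hs => ?_
      simp only [G, Finset.mem_filter] at hs
      obtain ⟨⟨hs1, hs2⟩, rfl⟩ := hs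
      rw [mul_assoc, mul_comm (monomial y u (s - τ s)), ← monomial_add, mdeg_sub (hτ' s hs2)]
    simp only [add_mul, Finset.sum_add_distrib]
    rw [h6, ← sub_sub, ← hlr, ← Finset.sum_filter_add_sum_filter_not l.support
      (fun s => f ∉ NN y u s), add_sub_cancel_left]
    refine Ideal.sum_mem _ fun s hs => ?_
    rw [Finset.mem_filter, not_not] at hs
    exact hbad s hs.1 hs.2

lemma exists_expansion_of {d : ℕ} [IsLocalRing R] {f y : R} {u : Fin d → R}
    (hM : Ideal.span (insert y (Set.range u)) = maximalIdeal R) (hI : Indep y u)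
    (hcl : ∀ (T : Finset ((Fin d → ℕ) × ℕ)) (K : ℕ) (r : ℕ → (Fin d → ℕ) × ℕ → R),
      (∀ n t, r (n + 1) t - r n t ∈ maximalIdeal R ^ (n - K)) →
      (∀ n, f - ∑ t ∈ T, r n t * monomial y u t ∈ maximalIdeal R ^ n) →
      ∃ a : (Fin d → ℕ) × ℕ → R, f = ∑ t ∈ T, a t * monomial y u t) :
    ∃ c, IsUnitExpansion f y u c := by
  classical
  let J : Set ((Fin d → ℕ) × ℕ) := {s | f ∉ NN y u s}
  have hfin : {s | Minimal (· ∈ J) s}.Finite :=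
    WellQuasiOrderedLE.finite_of_isAntichain (setOf_minimal_antichain _)
  let T := hfin.toFinset
  have hTm : ∀ t, t ∈ T ↔ Minimal (· ∈ J) t := fun t => hfin.mem_toFinset
  have hT : ∀ t ∈ T, f ∉ NN y u t := fun t ht => ((hTm t).1 ht).1
  have hT' : ∀ s, f ∉ NN y u s → ∃ t ∈ T, t ≤ s := fun s hs => by
    obtain ⟨t, hts, ht⟩ := exists_minimal_le_of_wellFoundedLT (· ∈ J) s hs
    exact ⟨t, (hTm t).2 ht, hts⟩
  let K := T.sup mdeg
  have hK : ∀ t ∈ T, mdeg t ≤ K := fun t ht => Finset.le_sup (f := mdeg) ht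
  have step := expansion_step hM hI T hT hT' K hK
  let Q : ℕ → Type _ := fun n => {r : (Fin d → ℕ) × ℕ → R //
    f - ∑ t ∈ T, r t * monomial y u t ∈ maximalIdeal R ^ n}
  let seq : ∀ n, Q n := fun n => Nat.rec (motive := Q) ⟨0, by simp⟩
    (fun n r => ⟨(step n r.1 r.2).choose, (step n r.1 r.2).choose_spec.2⟩) n
  obtain ⟨a, ha⟩ := hcl T K (fun n => (seq n).1)
    (fun n t => (step n (seq n).1 (seq n).2).choose_spec.1 t) (fun n => (seq n).2)
  refine ⟨Finsupp.onFinset T (fun t => if t ∈ T then a t else 0) (by intro t ht; by_contra h; simp [h] at ht),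
    ?_, ?_⟩
  · intro t ht
    have htT : t ∈ T := by
      by_contra h; simp [h] at ht
    simp only [Finsupp.onFinset_apply, htT, if_true]
    by_contra hu
    apply hT t htT
    rw [ha, ← Finset.add_sum_erase _ _ htT]
    refine Ideal.add_mem _ (mul_monomial_mem_NN _ _ _ ?_) (Ideal.sum_mem _ fun s hs => ?_)
    · rw [hM]; exact (mem_maximalIdeal _).2 hu
    · rw [Finset.mem_erase] at hs
      refine Ideal.mul_mem_left _ _ (monomial_mem_NN _ _ fun hle => hs.1 ?_)
      exact le_antisymm hle (((hTm t).1 htT).2 (hT s hs.2) hle)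
  · rw [Finsupp.onFinset_sum _ (by simp)]
    rw [ha]
    exact Finset.sum_congr rfl fun t ht => by simp [ht]

lemma exists_expansion_noeth {d : ℕ} [IsLocalRing R] [IsNoetherianRing R] {f y : R} {u : Fin d → R}
    (hM : Ideal.span (insert y (Set.range u)) = maximalIdeal R) (hI : Indep y u) :
    ∃ c, IsUnitExpansion f y u c := by
  refine exists_expansion_of hM hI fun T K r _ h => ?_
  have hmem : f ∈ Ideal.span (monomial y u '' (T : Set _)) := by
    set I := Ideal.span (monomial y u '' (T : Set _)) with hIdef
    have h0 := Ideal.iInf_pow_smul_eq_bot_of_isLocalRing (M := R ⧸ I) (maximalIdeal R)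
      Ideal.IsPrime.ne_top'
    have h1 : (Ideal.Quotient.mk I f) ∈ (⨅ i : ℕ, maximalIdeal R ^ i • ⊤ : Submodule R (R ⧸ I)) := by
      rw [Submodule.mem_iInf]
      intro n
      have h2 : Ideal.Quotient.mk I f = (f - ∑ t ∈ T, r n t * monomial y u t) • (1 : R ⧸ I) := by
        rw [Algebra.smul_def, mul_one, Ideal.Quotient.algebraMap_eq, map_sub]
        rw [Ideal.Quotient.eq_zero_iff_mem.2 (Ideal.sum_mem I fun t ht =>
          Ideal.mul_mem_left _ _ (Ideal.subset_span ⟨t, ht, rfl⟩)), sub_zero]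
      rw [h2]
      exact Submodule.smul_mem_smul (h n) trivial
    rw [h0] at h1
    exact Ideal.Quotient.eq_zero_iff_mem.1 h1
  rw [Ideal.span, Finsupp.mem_span_image_iff_linearCombination] at hmem
  obtain ⟨l, hl, hlr⟩ := hmem
  refine ⟨l, ?_⟩
  rw [← hlr, Finsupp.linearCombination_apply, Finsupp.sum]
  simp only [smul_eq_mul]
  refine Finset.sum_subset (fun s hs => hl hs) fun s _ hs => by
    rw [Finsupp.notMem_support_iff.1 hs, zero_mul]

lemma exists_expansion_complete {d : ℕ} [IsLocalRing R] [IsAdicComplete (maximalIdeal R) R]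
    {f y : R} {u : Fin d → R}
    (hM : Ideal.span (insert y (Set.range u)) = maximalIdeal R) (hI : Indep y u) :
    ∃ c, IsUnitExpansion f y u c := by
  refine exists_expansion_of hM hI fun T K r hr h => ?_
  have key : ∀ t, ∃ a, ∀ n, r (n + K) t - a ∈ maximalIdeal R ^ n := by
    intro t
    obtain ⟨a, ha⟩ := IsPrecomplete.prec (I := maximalIdeal R) (M := R) inferInstance
      (f := fun n => r (n + K) t) (fun {a b} hab => by
        rw [SModEq.sub_mem, smul_eq_mul, Ideal.mul_top]
        induction b, hab using Nat.le_induction with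
        | base => simp
        | succ b hab ih =>
          have h1 := hr (b + K) t
          have h2 : r (a + K) t - r (b + 1 + K) t =
            (r (a + K) t - r (b + K) t) - (r (b + K + 1) t - r (b + K) t) := by
            rw [show b + 1 + K = b + K + 1 by ring]; ring
          rw [h2]
          exact Ideal.sub_mem _ ih (Ideal.pow_le_pow_right (by omega) h1))
    refine ⟨a, fun n => ?_⟩
    have := ha n
    rwa [SModEq.sub_mem, smul_eq_mul, Ideal.mul_top] at this
  choose a ha using key
  refine ⟨a, ?_⟩
  rw [← sub_eq_zero]
  refine IsHausdorff.haus (I := maximalIdeal R) (M := R) inferInstance _ fun n => ?_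
  rw [SModEq.zero, smul_eq_mul, Ideal.mul_top]
  have h1 : f - ∑ t ∈ T, a t * monomial y u t = (f - ∑ t ∈ T, r (n + K) t * monomial y u t)
      + ∑ t ∈ T, (r (n + K) t - a t) * monomial y u t := by
    simp only [sub_mul, Finset.sum_sub_distrib]; ring
  rw [h1]
  exact Ideal.add_mem _ (Ideal.pow_le_pow_right (by omega) (h (n + K)))
    (Ideal.sum_mem _ fun t _ => Ideal.mul_mem_right _ _ (ha t n))
lemma isFSubset_half {d : ℕ} (L : Fin d → ℝ) (hL : ∀ i, 0 ≤ L i) (c : ℝ) :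
    IsFSubset {x : Fin d → ℝ | x ∈ orthant d ∧ c ≤ ∑ i, L i * x i} := by
  have hcl : IsClosed (orthant d) := by
    have : orthant d = ⋂ i, {x : Fin d → ℝ | 0 ≤ x i} := by ext; simp [orthant]
    rw [this]
    exact isClosed_iInter fun i => isClosed_le continuous_const (continuous_apply i)
  refine ⟨fun x hx => hx.1, ?_, ?_, ?_⟩
  · have h2 : IsClosed {x : Fin d → ℝ | c ≤ ∑ i, L i * x i} :=
      isClosed_le continuous_const (by fun_prop)
    exact hcl.inter h2
  · rintro x ⟨hx, hx'⟩ y ⟨hy, hy'⟩ a b ha hb hab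
    refine ⟨fun i => ?_, ?_⟩
    · have := hx i; have := hy i
      simp only [Pi.add_apply, Pi.smul_apply, smul_eq_mul]; positivity
    · have : ∑ i, L i * (a • x + b • y) i = a * ∑ i, L i * x i + b * ∑ i, L i * y i := by
        simp only [Pi.add_apply, Pi.smul_apply, smul_eq_mul, Finset.mul_sum,
          ← Finset.sum_add_distrib]
        exact Finset.sum_congr rfl fun i _ => by ring
      rw [this]
      calc c = a * c + b * c := by rw [← add_mul, hab, one_mul]
        _ ≤ _ := by gcongr
  · rintro x ⟨hx, hx'⟩ w hw
    refine ⟨fun i => add_nonneg (hx i) (hw i), ?_⟩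
    simp only [Pi.add_apply, mul_add, Finset.sum_add_distrib]
    have : 0 ≤ ∑ i, L i * w i := Finset.sum_nonneg fun i _ => mul_nonneg (hL i) (hw i)
    linarith

lemma subset_smallest {d : ℕ} (X : Set (Fin d → ℝ)) : X ⊆ smallestFSubset X :=
  fun _ hx _ hS => hS.2 hx

lemma smallest_subset {d : ℕ} {X S : Set (Fin d → ℝ)} (hS : IsFSubset S) (h : X ⊆ S) :
    smallestFSubset X ⊆ S := fun _ hx => hx _ ⟨hS, h⟩

lemma isFSubset_smallest {d : ℕ} {X : Set (Fin d → ℝ)} (hX : X ⊆ orthant d) :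
    IsFSubset (smallestFSubset X) := by
  refine ⟨?_, ?_, ?_, ?_⟩
  · refine smallest_subset (S := orthant d) ?_ hX
    have := isFSubset_half (d := d) (fun _ => 0) (fun _ => le_rfl) 0
    simpa using this
  · exact isClosed_sInter fun S hS => hS.1.2.1
  · exact convex_sInter fun S hS => hS.1.2.2.1
  · exact fun v hv w hw S hS => hS.1.2.2.2 v (hv S hS) w hw

lemma smallest_half {d : ℕ} {V : Set (Fin d → ℝ)} (hV : V ⊆ orthant d) (L : Fin d → ℝ)
    (hL : ∀ i, 0 ≤ L i) (c : ℝ) (h : ∀ v ∈ V, c ≤ ∑ i, L i * v i) (x : Fin d → ℝ)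
    (hx : x ∈ smallestFSubset V) : c ≤ ∑ i, L i * x i :=
  (smallest_subset (isFSubset_half L hL c) (fun v hv => ⟨hV hv, h v hv⟩) hx).2

lemma isVertex_smallest {d : ℕ} {V : Set (Fin d → ℝ)} (hV : V ⊆ orthant d) (hf : V.Finite)
    (v : Fin d → ℝ) (hv : v ∈ V) (L : Fin d → ℝ) (hL : ∀ i, 0 < L i)
    (h1 : ∑ i, L i * v i = 1) (h2 : ∀ w ∈ V, w ≠ v → 1 < ∑ i, L i * w i) :
    IsVertex (smallestFSubset V) v := by
  refine ⟨L, hL, ?_⟩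
  ext x
  simp only [Set.mem_inter_iff, Set.mem_ofPred_eq, Set.mem_singleton_iff]
  constructor
  · rintro ⟨hx, hx1⟩
    funext i
    have key : ∀ σ : ℝ, ∃ e : ℝ, 0 < e ∧ ∑ j, L j * x j - 1 ≥ e * σ * (x i - v i) := by
      intro σ
      have hev : ∀ w ∈ V, ∀ᶠ e in nhdsWithin (0:ℝ) (Set.Ioi 0),
          ∑ j, L j * w j - 1 ≥ e * σ * (w i - v i) := by
        intro w hw
        by_cases hwv : w = v
        · subst hwv; simp [h1]
        · have : Filter.Tendsto (fun e : ℝ => e * σ * (w i - v i)) (nhdsWithin (0:ℝ) (Set.Ioi 0))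
              (nhds (0 * σ * (w i - v i))) := by
            apply Filter.Tendsto.mono_left _ nhdsWithin_le_nhds
            exact Continuous.tendsto (by fun_prop) 0
          have h3 := h2 w hw hwv
          filter_upwards [this.eventually_lt_const (u := ∑ j, L j * w j - 1)
            (by rw [zero_mul, zero_mul]; linarith)] with e he
          exact he.le
      have hev1 := (Set.Finite.eventually_all hf).2 hev
      have hev2 : ∀ᶠ e in nhdsWithin (0:ℝ) (Set.Ioi 0), e * σ < L i := by
        have : Filter.Tendsto (fun e : ℝ => e * σ) (nhdsWithin (0:ℝ) (Set.Ioi 0))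
            (nhds (0 * σ)) := by
          apply Filter.Tendsto.mono_left _ nhdsWithin_le_nhds
          exact Continuous.tendsto (by fun_prop) 0
        exact this.eventually_lt_const (by simpa using hL i)
      obtain ⟨e, he1, he2, he3⟩ := (hev1.and (hev2.and self_mem_nhdsWithin)).exists
      refine ⟨e, he3, ?_⟩
      have hsum : ∀ w : Fin d → ℝ, ∑ j, (L j - if j = i then e * σ else 0) * w j
          = ∑ j, L j * w j - e * σ * w i := by
        intro w
        simp [sub_mul, Finset.sum_sub_distrib]
      have := smallest_half hV (fun j => L j - if j = i then e * σ else 0)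
        (fun j => by
          show 0 ≤ L j - if j = i then e * σ else 0
          split_ifs with h
          · subst h; linarith
          · have := hL j; linarith)
        (1 - e * σ * v i) (fun w hw => by
          rw [hsum]
          have := he1 w hw
          linarith) x hx
      rw [hsum] at this
      linarith
    obtain ⟨e, he, h3⟩ := key 1
    obtain ⟨e', he', h4⟩ := key (-1)
    have h5 : e * (x i - v i) ≤ 0 := by linarith
    have h6 : e' * (v i - x i) ≤ 0 := by linarith
    have := nonpos_of_mul_nonpos_right h5 he
    have := nonpos_of_mul_nonpos_right h6 he'
    linarith
  · rintro rfl
    exact ⟨subset_smallest _ hv, h1⟩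

lemma mem_of_isVertex {V : Set (Fin 3 → ℝ)} (hV : V ⊆ orthant 3) (hf : V.Finite)
    (w : Fin 3 → ℝ) (h : IsVertex (smallestFSubset V) w) : w ∈ V := by
  obtain ⟨L, hL, hE⟩ := h
  have hw : w ∈ smallestFSubset V ∩ {x | ∑ i, L i * x i = 1} := by rw [hE]; rfl
  have huniq : ∀ x, x ∈ smallestFSubset V → ∑ i, L i * x i = 1 → x = w := by
    intro x hx hx1
    have : x ∈ smallestFSubset V ∩ {x | ∑ i, L i * x i = 1} := ⟨hx, hx1⟩
    rwa [hE] at this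
  have hF := isFSubset_smallest hV
  have hge : ∀ q ∈ smallestFSubset V, 1 ≤ ∑ i, L i * q i := by
    intro q hq
    by_contra hlt
    push Not at hlt
    have h0 := hL 0
    have h1 := hL 1
    have hsub : 0 < 1 - ∑ i, L i * q i := by linarith
    have e0 := huniq (q + ![(1 - ∑ i, L i * q i) / L 0, 0, 0])
      (hF.2.2.2 q hq _ (fun i => by fin_cases i <;> simp <;> positivity)) (by
        simp [Fin.sum_univ_three]; field_simp; ring)
    have e1 := huniq (q + ![0, (1 - ∑ i, L i * q i) / L 1, 0])
      (hF.2.2.2 q hq _ (fun i => by fin_cases i <;> simp <;> positivity)) (by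
        simp [Fin.sum_univ_three]; field_simp; ring)
    have := congrFun (e0.trans e1.symm) 0
    simp only [Pi.add_apply, Matrix.cons_val_zero, add_zero] at this
    have : 0 < (1 - ∑ i, L i * q i) / L 0 := by positivity
    linarith
  by_contra hwV
  have hgt : ∀ v ∈ V, 1 < ∑ i, L i * v i := by
    intro v hv
    refine lt_of_le_of_ne (hge v (subset_smallest _ hv)) fun he => hwV ?_
    rw [← huniq v (subset_smallest _ hv) he.symm]
    exact hv
  have hc : ∃ c : ℝ, 1 < c ∧ ∀ v ∈ V, c ≤ ∑ i, L i * v i := by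
    have hev : ∀ v ∈ V, ∀ᶠ c in nhdsWithin (1:ℝ) (Set.Ioi 1), c ≤ ∑ i, L i * v i := fun v hv =>
      nhdsWithin_le_nhds ((eventually_lt_nhds (hgt v hv)).mono fun _ h => h.le)
    obtain ⟨c, h1, h2⟩ := (((Set.Finite.eventually_all hf).2 hev).and self_mem_nhdsWithin).exists
    exact ⟨c, h2, h1⟩
  obtain ⟨c, hc1, hc2⟩ := hc
  have := smallest_half hV L (fun i => (hL i).le) c hc2 w hw.1
  have := hw.2
  simp only [Set.mem_ofPred_eq] at this
  linarith

lemma vertices_smallest {V : Set (Fin 3 → ℝ)} (hV : V ⊆ orthant 3) (hf : V.Finite)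
    (h : ∀ v ∈ V, ∃ L : Fin 3 → ℝ, (∀ i, 0 < L i) ∧ ∑ i, L i * v i = 1 ∧
      ∀ w ∈ V, w ≠ v → 1 < ∑ i, L i * w i) :
    {v | IsVertex (smallestFSubset V) v} = V := by
  ext v
  refine ⟨mem_of_isVertex hV hf v, fun hv => ?_⟩
  obtain ⟨L, h1, h2, h3⟩ := h v hv
  exact isVertex_smallest hV hf v hv L h1 h2 h3

lemma expPoints_orthant {d : ℕ} (m : ℕ) (s : Finset ((Fin d → ℕ) × ℕ)) :
    expPoints m s ⊆ orthant d := by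
  rintro x ⟨ab, _, hlt, rfl⟩ i
  have : (ab.2 : ℝ) < m := by exact_mod_cast hlt
  exact div_nonneg (Nat.cast_nonneg _) (by linarith)

lemma isFSubset_DeltaOf {d : ℕ} (f y : R) (u : Fin d → R) (m : ℕ) :
    IsFSubset (DeltaOf f y u m) :=
  isFSubset_smallest (Set.iUnion₂_subset fun _ _ => expPoints_orthant _ _)

lemma proj_mono {d : ℕ} {Δ : Set (Fin d → ℝ)} (hΔ : IsFSubset Δ) {p : ℕ}
    {t s : (Fin d → ℕ) × ℕ} (hts : t ≤ s) (hs : s.2 < p) (h : projPoint p t ∈ Δ) :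
    projPoint p s ∈ Δ := by
  have := hΔ.2.2.2 _ h (projPoint p s - projPoint p t) (fun i => by
    simp only [Pi.sub_apply, sub_nonneg, projPoint]
    have h1 : (t.1 i : ℝ) ≤ s.1 i := by exact_mod_cast hts.1 i
    have h2 : (t.2 : ℝ) ≤ s.2 := by exact_mod_cast hts.2
    have h3 : (s.2 : ℝ) < p := by exact_mod_cast hs
    exact div_le_div₀ (Nat.cast_nonneg _) h1 (by linarith) (by linarith))
  simpa using this

lemma proj_mem_DeltaOf {d : ℕ} {f y : R} {u : Fin d → R} {p : ℕ}
    (hex : ∃ c, IsUnitExpansion f y u c) (s : (Fin d → ℕ) × ℕ) (hs : s.2 < p)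
    (hf : f ∉ NN y u s) : projPoint p s ∈ DeltaOf f y u p := by
  obtain ⟨c, hc⟩ := hex
  obtain ⟨t, ht, hts⟩ := exists_support_le hc s hf
  refine proj_mono (isFSubset_DeltaOf _ _ _ _) hts hs (subset_smallest _ ?_)
  exact Set.mem_biUnion (x := c) hc ⟨t, ht, lt_of_le_of_lt hts.2 hs, rfl⟩

lemma DeltaOf_subset {d : ℕ} {f y : R} {u : Fin d → R} {p : ℕ} (hI : Indep y u)
    (T : Set ((Fin d → ℕ) × ℕ)) (hf : f ∈ Ideal.span (monomial y u '' T))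
    {S : Set (Fin d → ℝ)} (hS : IsFSubset S) (h : ∀ t ∈ T, t.2 < p → projPoint p t ∈ S) :
    DeltaOf f y u p ⊆ S := by
  refine smallest_subset hS (Set.iUnion₂_subset fun c hc => ?_)
  rintro _ ⟨s, hs, hlt, rfl⟩
  obtain ⟨t, ht, hts⟩ := support_ge hI hc T hf s hs
  exact proj_mono hS hts hlt (h t ht (lt_of_le_of_lt hts.2 hlt))

/-! vertex sets -/

lemma vertices_case1 (p : ℕ) (hp : 2 ≤ p) :
    {v | IsVertex (smallestFSubset
      ({![0, 1 / (p : ℝ), 1], ![1 + 1 / (p : ℝ), 0, 0]} : Set (Fin 3 → ℝ))) v} =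
      ({![0, 1 / (p : ℝ), 1], ![1 + 1 / (p : ℝ), 0, 0]} : Set (Fin 3 → ℝ)) := by
  have hp' : (2 : ℝ) ≤ p := by exact_mod_cast hp
  have hp0 : (0 : ℝ) < p := by linarith
  apply vertices_smallest
  · rintro v (rfl | rfl) i <;> fin_cases i <;> simp <;> positivity
  · exact Set.toFinite _
  · rintro v (rfl | rfl)
    · refine ⟨![2, p / 2, 1 / 2], fun i => by fin_cases i <;> simp <;> positivity, ?_, ?_⟩
      · simp [Fin.sum_univ_three]; field_simp; norm_num
      · rintro w (rfl | rfl) hw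
        · exact absurd rfl hw
        · simp [Fin.sum_univ_three]
          have : 0 < (p:ℝ)⁻¹ := by positivity
          linarith
    · refine ⟨![p / (p + 1), 1, 2], fun i => by fin_cases i <;> simp <;> positivity, ?_, ?_⟩
      · simp [Fin.sum_univ_three]; field_simp
      · rintro w (rfl | rfl) hw
        · simp [Fin.sum_univ_three]
          have : 0 < (p:ℝ)⁻¹ := by positivity
          linarith
        · exact absurd rfl hw

lemma vertices_case2 (p : ℕ) (hp : 2 ≤ p) :
    {v | IsVertex (smallestFSubset
      ({![0, 1 / (p : ℝ), 1], ![1 + 1 / ((p : ℝ) - 1), 0, 0],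
          ![1 + 1 / (p : ℝ), 0, 1 / (p : ℝ)]} : Set (Fin 3 → ℝ))) v} =
      ({![0, 1 / (p : ℝ), 1], ![1 + 1 / ((p : ℝ) - 1), 0, 0],
          ![1 + 1 / (p : ℝ), 0, 1 / (p : ℝ)]} : Set (Fin 3 → ℝ)) := by
  have hp' : (2 : ℝ) ≤ p := by exact_mod_cast hp
  obtain ⟨q, hq⟩ : ∃ q : ℝ, q = p - 1 := ⟨_, rfl⟩
  have hpq : (p : ℝ) = q + 1 := by linarith
  have hq1 : 1 ≤ q := by linarith
  rw [hpq, add_sub_cancel_right]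
  have hqi : 0 < 1 / q := by positivity
  have hqi' : 0 < 1 / (q + 1) := by positivity
  apply vertices_smallest
  · rintro v (rfl | rfl | rfl) i <;> fin_cases i <;> simp <;> positivity
  · exact Set.toFinite _
  · rintro v (rfl | rfl | rfl)
    · refine ⟨![2, (q + 1) / 2, 1 / 2], fun i => by fin_cases i <;> simp <;> positivity, ?_, ?_⟩
      · simp [Fin.sum_univ_three]; field_simp; norm_num
      · rintro w (rfl | rfl | rfl) hw
        · exact absurd rfl hw
        · simp only [Fin.sum_univ_three, Matrix.cons_val]
          linarith
        · simp only [Fin.sum_univ_three, Matrix.cons_val]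
          linarith
    · refine ⟨![q / (q + 1), 1, 2 * (q + 1)],
        fun i => by fin_cases i <;> simp <;> positivity, ?_, ?_⟩
      · simp [Fin.sum_univ_three]; field_simp
      · rintro w (rfl | rfl | rfl) hw
        · simp only [Fin.sum_univ_three, Matrix.cons_val]
          nlinarith
        · exact absurd rfl hw
        · simp only [Fin.sum_univ_three, Matrix.cons_val]
          have h1 : 2 * (q + 1) * (1 / (q + 1)) = 2 := by field_simp
          have h2 : 0 < q / (q + 1) * (1 + 1 / (q + 1)) := by positivity
          linarith
    · refine ⟨![(2 * (q + 1) ^ 2 - 1) / (2 * (q + 1) * (q + 2)), 2 * (q + 1), 1 / (2 * (q + 1))],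
        fun i => ?_, ?_, ?_⟩
      · have : 0 < 2 * (q + 1) ^ 2 - 1 := by nlinarith
        fin_cases i <;> simp <;> positivity
      · simp [Fin.sum_univ_three]; field_simp; ring
      · rintro w (rfl | rfl | rfl) hw
        · simp only [Fin.sum_univ_three, Matrix.cons_val]
          have h1 : 2 * (q + 1) * (1 / (q + 1)) = 2 := by field_simp
          have h2 : 0 < 1 / (2 * (q + 1)) := by positivity
          linarith
        · simp only [Fin.sum_univ_three, Matrix.cons_val, mul_zero, add_zero]
          rw [show 1 + 1 / q = (q + 1) / q by field_simp, div_mul_div_comm, one_lt_div (by positivity)]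
          nlinarith
        · exact absurd rfl hw
lemma monomial_map {S : Type*} [CommRing S] (φ : R →+* S) {d : ℕ} (y : R) (u : Fin d → R)
    (s : (Fin d → ℕ) × ℕ) : monomial (φ y) (fun i => φ (u i)) s = φ (monomial y u s) := by
  simp [monomial]

lemma NN_map {S : Type*} [CommRing S] (φ : R →+* S) {d : ℕ} (y : R) (u : Fin d → R)
    (s : (Fin d → ℕ) × ℕ) : NN (φ y) (fun i => φ (u i)) s = (NN y u s).map φ := by
  rw [NN, NN, Ideal.map_span, Set.image_insert_eq, ← Set.range_comp]
  simp [Function.comp_def]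

abbrev AA := Polynomial (MvPolynomial (Fin 2) ℤ)

def phi : AA →+* ℤ := MvPolynomial.constantCoeff.comp Polynomial.constantCoeff

lemma sub_phi_mem (I : Ideal AA) (h2 : Polynomial.C (MvPolynomial.X 0) ∈ I)
    (h3 : Polynomial.C (MvPolynomial.X 1) ∈ I) (hX : Polynomial.X ∈ I) (g : AA) :
    g - (phi g : ℤ) ∈ I := by
  have : ((Ideal.Quotient.mk I).comp ((Int.castRingHom AA).comp phi)) = Ideal.Quotient.mk I := by
    apply Polynomial.ringHom_ext'
    · apply MvPolynomial.ringHom_ext'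
      · exact RingHom.ext_int _ _
      · intro i
        fin_cases i
        · simp [phi, Ideal.Quotient.eq_zero_iff_mem.2 h2]
        · simp [phi, Ideal.Quotient.eq_zero_iff_mem.2 h3]
    · simp [phi, Ideal.Quotient.eq_zero_iff_mem.2 hX]
  have h := RingHom.congr_fun this g
  simp only [RingHom.comp_apply, eq_intCast] at h
  exact Ideal.Quotient.eq.1 h.symm

def ee (a b : ℕ) : Fin 2 →₀ ℕ := Finsupp.single 0 a + Finsupp.single 1 b

lemma coeff_dvd (p : ℕ) (y : AA) (u : Fin 3 → AA) (hy : y = Polynomial.X)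
    (hu : u = ![(p : AA), Polynomial.C (MvPolynomial.X 0), Polynomial.C (MvPolynomial.X 1)])
    (s : (Fin 3 → ℕ) × ℕ) (g : AA) (hg : g ∈ NN y u s) (c : ℕ) (hc : c ≤ s.2)
    (e : Fin 2 →₀ ℕ) (he : e ≤ ee (s.1 1) (s.1 2)) :
    (p : ℤ) ^ (s.1 0 + 1) ∣ (g.coeff c).coeff e := by
  let J : Ideal AA :=
    { carrier := {g | ∀ c ≤ s.2, ∀ e ≤ ee (s.1 1) (s.1 2),
        (p : ℤ) ^ (s.1 0 + 1) ∣ (g.coeff c).coeff e}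
      add_mem' := by
        intro a b ha hb c hc e he
        rw [Polynomial.coeff_add, MvPolynomial.coeff_add]
        exact dvd_add (ha c hc e he) (hb c hc e he)
      zero_mem' := by intro c _ e _; simp
      smul_mem' := by
        intro r g hg c hc e he
        rw [smul_eq_mul, Polynomial.coeff_mul, MvPolynomial.coeff_sum]
        refine Finset.dvd_sum fun x hx => ?_
        rw [MvPolynomial.coeff_mul]
        refine Finset.dvd_sum fun x' hx' => ?_
        refine Dvd.dvd.mul_left (hg _ ?_ _ ?_) _
        · have := Finset.HasAntidiagonal.mem_antidiagonal.1 hx; omega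
        · rw [← Finset.HasAntidiagonal.mem_antidiagonal.1 hx'] at he
          exact le_trans le_add_self he }
  have hJ : NN y u s ≤ J := by
    rw [NN, Ideal.span_le]
    rintro _ (rfl | ⟨i, rfl⟩)
    · intro c hc e he
      rw [hy, Polynomial.coeff_X_pow, if_neg (by omega)]
      simp
    · subst hu
      fin_cases i
      · intro c hc e he
        have : ((p : AA) ^ (s.1 0 + 1)) = Polynomial.C (MvPolynomial.C ((p : ℤ) ^ (s.1 0 + 1))) := by
          simp
        show (p : ℤ) ^ (s.1 0 + 1) ∣ (((p : AA) ^ (s.1 0 + 1)).coeff c).coeff e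
        rw [this, Polynomial.coeff_C]
        split_ifs
        · rw [MvPolynomial.coeff_C]
          split_ifs <;> simp
        · simp
      · intro c hc e he
        show (p : ℤ) ^ (s.1 0 + 1) ∣
          (((Polynomial.C (MvPolynomial.X 0) : AA) ^ (s.1 1 + 1)).coeff c).coeff e
        rw [← Polynomial.C_pow, Polynomial.coeff_C]
        split_ifs
        · rw [MvPolynomial.coeff_X_pow, if_neg]
          · simp
          · rintro rfl
            have := he 0
            simp [ee] at this
        · simp
      · intro c hc e he
        show (p : ℤ) ^ (s.1 0 + 1) ∣
          (((Polynomial.C (MvPolynomial.X 1) : AA) ^ (s.1 2 + 1)).coeff c).coeff e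
        rw [← Polynomial.C_pow, Polynomial.coeff_C]
        split_ifs
        · rw [MvPolynomial.coeff_X_pow, if_neg]
          · simp
          · rintro rfl
            have := he 1
            simp [ee] at this
        · simp
  exact hJ hg c hc e he

lemma coeff_mul_mono (p : ℕ) (s : (Fin 3 → ℕ) × ℕ) (r : AA) :
    ((r * monomial (Polynomial.X : AA)
      ![(p : AA), Polynomial.C (MvPolynomial.X 0), Polynomial.C (MvPolynomial.X 1)] s).coeff
        s.2).coeff (ee (s.1 1) (s.1 2)) = phi r * p ^ s.1 0 := by
  have : monomial (Polynomial.X : AA)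
      ![(p : AA), Polynomial.C (MvPolynomial.X 0), Polynomial.C (MvPolynomial.X 1)] s =
      Polynomial.C (MvPolynomial.monomial (ee (s.1 1) (s.1 2)) ((p : ℤ) ^ s.1 0)) *
        Polynomial.X ^ s.2 := by
    have h1 : (MvPolynomial.monomial (ee (s.1 1) (s.1 2)) ((p : ℤ) ^ s.1 0)) =
      (p : MvPolynomial (Fin 2) ℤ) ^ s.1 0 * (MvPolynomial.X 0 ^ s.1 1 * MvPolynomial.X 1 ^ s.1 2) := by
      rw [MvPolynomial.X_pow_eq_monomial, MvPolynomial.X_pow_eq_monomial, MvPolynomial.monomial_mul,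
        show (p : MvPolynomial (Fin 2) ℤ) ^ s.1 0 = MvPolynomial.C ((p : ℤ) ^ s.1 0) by simp,
        MvPolynomial.C_mul_monomial, ee]
      simp
    rw [h1]
    simp only [monomial, Fin.prod_univ_three, Matrix.cons_val, map_mul, map_pow, map_natCast]
    ring
  rw [this, ← mul_assoc]
  have h2 := Polynomial.coeff_mul_X_pow
    (r * Polynomial.C (MvPolynomial.monomial (ee (s.1 1) (s.1 2)) ((p : ℤ) ^ s.1 0))) s.2 0
  rw [zero_add] at h2
  rw [h2, Polynomial.coeff_mul_C]
  have h3 := MvPolynomial.coeff_mul_monomial 0 (ee (s.1 1) (s.1 2)) ((p : ℤ) ^ s.1 0) (r.coeff 0)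
  rw [zero_add] at h3
  rw [h3]
  rfl

lemma phi_dvd (p : ℕ) (hp : p ≠ 0) (s : (Fin 3 → ℕ) × ℕ) (r : AA)
    (h : r * monomial (Polynomial.X : AA)
      ![(p : AA), Polynomial.C (MvPolynomial.X 0), Polynomial.C (MvPolynomial.X 1)] s ∈
      NN (Polynomial.X : AA)
      ![(p : AA), Polynomial.C (MvPolynomial.X 0), Polynomial.C (MvPolynomial.X 1)] s) :
    (p : ℤ) ∣ phi r := by
  have := coeff_dvd p _ _ rfl rfl s _ h s.2 le_rfl _ le_rfl
  rw [coeff_mul_mono, pow_succ'] at this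
  exact Int.dvd_of_mul_dvd_mul_right (by positivity) this

section loc

variable (p : ℕ) (hp : p.Prime) (P : Ideal AA) [P.IsPrime]
  (R : Type u) [CommRing R] [IsLocalRing R] [Algebra AA R] [IsLocalization.AtPrime R P]
  (hP : P = Ideal.span {(p : AA), Polynomial.C (MvPolynomial.X 0),
    Polynomial.C (MvPolynomial.X 1), Polynomial.X})

def uu (p : ℕ) : Fin 3 → AA :=
  ![(p : AA), Polynomial.C (MvPolynomial.X 0), Polynomial.C (MvPolynomial.X 1)]

def yl (R : Type u) [CommRing R] [Algebra AA R] : R := algebraMap AA _ Polynomial.X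
def ull (p : ℕ) (R : Type u) [CommRing R] [Algebra AA R] : Fin 3 → R := fun i => algebraMap AA _ (uu p i)

include hP

lemma P_eq : P = Ideal.span (insert Polynomial.X (Set.range (uu p))) := by
  rw [hP]
  congr 1
  ext x
  simp only [Set.mem_insert_iff, Set.mem_singleton_iff, Set.mem_range, uu, Fin.exists_fin_succ,
    Matrix.cons_val]
  simp
  tauto

lemma sub_phi_memP (g : AA) : g - (phi g : ℤ) ∈ P :=
  sub_phi_mem P (by rw [hP]; exact Ideal.subset_span (by simp))
    (by rw [hP]; exact Ideal.subset_span (by simp)) (by rw [hP]; exact Ideal.subset_span (by simp)) g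

lemma mem_P_of_dvd (g : AA) (h : (p : ℤ) ∣ phi g) : g ∈ P := by
  have h1 := sub_phi_memP p P hP g
  obtain ⟨k, hk⟩ := h
  have : g = (g - (phi g : ℤ)) + k * (p : AA) := by rw [hk]; push_cast; ring
  rw [this]
  refine P.add_mem h1 (P.mul_mem_left _ ?_)
  rw [hP]; exact Ideal.subset_span (by simp)

lemma indep_std (hp : p.Prime) : Indep (yl R) (ull p R) := by
  intro s r h hr
  obtain ⟨⟨a, t⟩, hat⟩ := IsLocalization.surj P.primeCompl r
  simp only at hat
  have h1 : algebraMap AA R (a * monomial Polynomial.X (uu p) s) ∈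
      (NN Polynomial.X (uu p) s).map (algebraMap AA R) := by
    rw [← NN_map (algebraMap AA R), map_mul, ← monomial_map (algebraMap AA R), ← hat, mul_right_comm]
    exact Ideal.mul_mem_right _ _ h
  rw [IsLocalization.mem_map_algebraMap_iff P.primeCompl] at h1
  obtain ⟨⟨⟨x, hx⟩, w⟩, hw⟩ := h1
  simp only at hw
  rw [← map_mul, IsLocalization.eq_iff_exists P.primeCompl] at hw
  obtain ⟨c, hc⟩ := hw
  have h2 : ((c : AA) * a * w) * monomial Polynomial.X (uu p) s ∈ NN Polynomial.X (uu p) s := by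
    have : ((c : AA) * a * w) * monomial Polynomial.X (uu p) s = c * x := by rw [← hc]; ring
    rw [this]
    exact Ideal.mul_mem_left _ _ hx
  have h3 := mem_P_of_dvd p P hP _ (phi_dvd p hp.ne_zero s _ h2)
  have h4 : a ∈ P := by
    rcases (‹P.IsPrime›.mem_or_mem h3) with h | h
    · rcases (‹P.IsPrime›.mem_or_mem h) with h | h
      · exact absurd h c.2
      · exact h
    · exact absurd h w.2
  have h5 : IsUnit (algebraMap AA R a) := by
    rw [← hat]; exact hr.mul (IsLocalization.map_units _ t)
  exact (IsLocalization.AtPrime.isUnit_to_map_iff R P a).1 h5 h4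

lemma maxl : Ideal.span (insert (yl R) (Set.range (ull p R))) =
    maximalIdeal R := by
  rw [← IsLocalization.AtPrime.map_eq_maximalIdeal P R]
  have h := congrArg (Ideal.map (algebraMap AA R)) (P_eq p P hP)
  rw [h, Ideal.map_span, Set.image_insert_eq, ← Set.range_comp]
  rfl

omit hP in
lemma p_mem (hP : P = Ideal.span {(p : AA), Polynomial.C (MvPolynomial.X 0),
    Polynomial.C (MvPolynomial.X 1), Polynomial.X}) :
    ((p : ℕ) : R) ∈ maximalIdeal R := by
  rw [← maxl p P R hP]
  exact Ideal.subset_span (Or.inr ⟨0, by simp [ull, uu]⟩)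

lemma exists_int (hp : p.Prime) (r : R) :
    ∃ n : ℤ, r - n ∈ maximalIdeal R := by
  obtain ⟨⟨a, t⟩, hat⟩ := IsLocalization.surj P.primeCompl r
  simp only at hat
  have hmem : ∀ g : AA, algebraMap AA R g - (phi g : ℤ) ∈
      maximalIdeal R := by
    intro g
    have := (IsLocalization.AtPrime.to_map_mem_maximal_iff R P
      (g - (phi g : ℤ))).2 (sub_phi_memP p P hP g)
    simpa using this
  have ht : ¬ (p : ℤ) ∣ phi t := fun h => t.2 (mem_P_of_dvd p P hP _ h)
  have hcop : IsCoprime (p : ℤ) (phi t) :=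
    ((Nat.prime_iff_prime_int.1 hp).coprime_iff_not_dvd).2 ht
  obtain ⟨α, β, hab⟩ := hcop
  refine ⟨phi a * β, ?_⟩
  have h1 := hmem a
  have h2 := hmem t
  have h3 := p_mem p P R hP
  set M := maximalIdeal R
  have hab' : (α : R) * p + β * (phi t : ℤ) = 1 := by
    have := congrArg (Int.cast (R := R)) hab
    push_cast at this
    exact this
  set A' := algebraMap AA R a
  set T' := algebraMap AA R t
  have : r - ((phi a * β : ℤ) : R) =
      r * α * p - r * β * (T' - (phi t : ℤ)) + β * (A' - (phi a : ℤ)) := by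
    push_cast
    have : A' = r * T' := hat.symm
    rw [this]
    linear_combination (-r) * hab'
  rw [this]
  exact M.add_mem (M.sub_mem (M.mul_mem_left _ h3) (M.mul_mem_left _ h2)) (M.mul_mem_left _ h1)

lemma exists_endo (Y : R)
    (hY : Y ∈ maximalIdeal R) :
    ∃ ψ : R →+* R,
      ψ (yl R) = Y ∧ ∀ i, ψ (ull p R i) = ull p R i := by
  let ψ0 : AA →+* R :=
    Polynomial.eval₂RingHom ((algebraMap AA R).comp Polynomial.C) Y
  have hcomap : P ≤ (maximalIdeal R).comap ψ0 := by
    conv_lhs => rw [P_eq p P hP]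
    rw [Ideal.span_le]
    rintro _ (rfl | ⟨i, rfl⟩)
    · simpa [ψ0] using hY
    · have h : ull p R i ∈ maximalIdeal R := by
        rw [← maxl p P R hP]
        exact Ideal.subset_span (Or.inr ⟨i, rfl⟩)
      have : ψ0 (uu p i) = ull p R i := by
        fin_cases i <;> simp [ψ0, uu, ull]
      simpa [this] using h
  have hPmax : P.IsMaximal ∨ True := Or.inr trivial
  have hunit : ∀ t : P.primeCompl, IsUnit (ψ0 t) := by
    intro t
    have h1 := hcomap (sub_phi_memP p P hP t)
    rw [Ideal.mem_comap, map_sub, map_intCast] at h1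
    by_contra hcon
    have h2 : ψ0 t ∈ maximalIdeal R := hcon
    have h3 : ((phi t : ℤ) : R) ∈ maximalIdeal R := by
      have := Ideal.sub_mem _ h2 h1
      simpa using this
    have h4 : ((phi t : ℤ) : AA) ∈ P := by
      refine (IsLocalization.AtPrime.to_map_mem_maximal_iff R P _).1 ?_
      simpa using h3
    have h5 := P.add_mem (sub_phi_memP p P hP t) h4
    rw [sub_add_cancel] at h5
    exact t.2 h5
  refine ⟨IsLocalization.lift (M := P.primeCompl) hunit, ?_, fun i => ?_⟩
  · rw [yl, IsLocalization.lift_eq]; simp [ψ0]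
  · rw [ull, IsLocalization.lift_eq]
    fin_cases i <;> simp [ψ0, uu]

end loc
lemma indep_endo {d : ℕ} [IsLocalRing R] [IsNoetherianRing R] (p : ℕ) (hp : 0 < p)
    (hpM : (p : R) ∈ maximalIdeal R) (hint : ∀ r : R, ∃ n : ℤ, r - n ∈ maximalIdeal R)
    {y Y : R} {u : Fin d → R} (hM : Ideal.span (insert y (Set.range u)) = maximalIdeal R)
    (hMY : Ideal.span (insert Y (Set.range u)) = maximalIdeal R) (hI : Indep y u)
    (ψ : R →+* R) (hy : ψ y = Y) (hu : ∀ i, ψ (u i) = u i) : Indep Y u := by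
  have hfin : Finite (R ⧸ maximalIdeal R) := by
    refine Finite.of_surjective (fun i : Fin p => (((i : ℕ) : R) : R ⧸ maximalIdeal R)) ?_
    intro x
    obtain ⟨r, rfl⟩ := Ideal.Quotient.mk_surjective x
    obtain ⟨n, hn⟩ := hint r
    have hp' : (0 : ℤ) < p := by exact_mod_cast hp
    have h0 := Int.emod_nonneg n hp'.ne'
    have h1 := Int.emod_lt_of_pos n hp'
    refine ⟨⟨(n % p).toNat, by omega⟩, ?_⟩
    refine Ideal.Quotient.eq.2 ?_
    have h2 : (((n % p).toNat : ℕ) : R) = ((n % p : ℤ) : R) := by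
      rw [← Int.cast_natCast, Int.toNat_of_nonneg h0]
    have h3 : (n : R) = ((n % p : ℤ) : R) + p * ((n / p : ℤ) : R) := by
      have := congrArg (Int.cast (R := R)) (Int.emod_add_mul_ediv n p)
      push_cast at this
      rw [← this]
    have : (((n % p).toNat : ℕ) : R) - r = -(r - n) - ((n / p : ℤ) : R) * p := by
      rw [h2, h3]; ring
    rw [this]
    exact Ideal.sub_mem _ (Ideal.neg_mem_iff _ |>.2 hn) (Ideal.mul_mem_left _ _ hpM)
  have hmap : (maximalIdeal R).map ψ = maximalIdeal R := by
    conv_lhs => rw [← hM]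
    rw [← hMY, Ideal.map_span, Set.image_insert_eq, ← Set.range_comp, hy]
    congr 3
    funext i
    exact hu i
  have hmapn : ∀ n, (maximalIdeal R ^ n).map ψ = maximalIdeal R ^ n := by
    intro n; rw [Ideal.map_pow, hmap]
  have hsurj : ∀ n, ∀ x : R, ∃ x', x - ψ x' ∈ maximalIdeal R ^ n := by
    intro n
    induction n with
    | zero => intro x; exact ⟨0, by simp⟩
    | succ n ih =>
      have key : ∀ x ∈ (maximalIdeal R ^ n).map ψ, ∃ x', x - ψ x' ∈ maximalIdeal R ^ (n + 1) := by
        intro x hx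
        rw [Ideal.map] at hx
        induction hx using Submodule.span_induction with
        | mem x h => obtain ⟨a, _, rfl⟩ := h; exact ⟨a, by simp⟩
        | zero => exact ⟨0, by simp⟩
        | add x z _ _ hx hz =>
          obtain ⟨x', hx⟩ := hx
          obtain ⟨z', hz⟩ := hz
          refine ⟨x' + z', ?_⟩
          have := Ideal.add_mem _ hx hz
          rw [map_add]; convert this using 1; ring
        | smul a x hx0 hx =>
          obtain ⟨x', hx⟩ := hx
          obtain ⟨k, hk⟩ := hint a
          refine ⟨k * x', ?_⟩
          have hxn : x ∈ maximalIdeal R ^ n := by rw [← hmapn n]; exact hx0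
          have h1 : (a - k) * x ∈ maximalIdeal R ^ (n + 1) := by
            rw [pow_succ']; exact Ideal.mul_mem_mul hk hxn
          have : a • x - ψ (k * x') = (a - k) * x + k * (x - ψ x') := by
            rw [map_mul, map_intCast, smul_eq_mul]; ring
          rw [this]
          exact Ideal.add_mem _ h1 (Ideal.mul_mem_left _ _ hx)
      intro x
      obtain ⟨x1, h1⟩ := ih x
      rw [← hmapn n] at h1
      obtain ⟨x2, h2⟩ := key _ h1
      refine ⟨x1 + x2, ?_⟩
      rw [map_add]; convert h2 using 1; ring
  have hinj : ∀ n, ∀ x : R, ψ x ∈ maximalIdeal R ^ n → x ∈ maximalIdeal R ^ n := by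
    intro n x hx
    have : Finite (R ⧸ maximalIdeal R ^ n) :=
      Ideal.finite_quotient_pow (IsNoetherian.noetherian _) n
    let ψb : R ⧸ maximalIdeal R ^ n →+* R ⧸ maximalIdeal R ^ n :=
      Ideal.quotientMap _ ψ (Ideal.map_le_iff_le_comap.1 (hmapn n).le)
    have hs : Function.Surjective ψb := by
      intro q
      obtain ⟨r, rfl⟩ := Ideal.Quotient.mk_surjective q
      obtain ⟨r', hr'⟩ := hsurj n r
      refine ⟨Ideal.Quotient.mk _ r', ?_⟩
      rw [Ideal.quotientMap_mk]
      exact (Ideal.Quotient.eq.2 hr').symm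
    have hi := Finite.injective_iff_surjective.2 hs
    apply Ideal.Quotient.eq_zero_iff_mem.1
    apply hi
    rw [map_zero, Ideal.quotientMap_mk]
    exact Ideal.Quotient.eq_zero_iff_mem.2 hx
  intro s r hr hru
  have hlift : ∀ I : Ideal R, ∀ n, ∀ x ∈ I.map ψ, ∃ a ∈ I, x - ψ a ∈ maximalIdeal R ^ n := by
    intro I n x hx
    rw [Ideal.map] at hx
    induction hx using Submodule.span_induction with
    | mem x h => obtain ⟨a, ha, rfl⟩ := h; exact ⟨a, ha, by simp⟩
    | zero => exact ⟨0, I.zero_mem, by simp⟩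
    | add x z _ _ hx hz =>
      obtain ⟨x', hx', hx⟩ := hx
      obtain ⟨z', hz', hz⟩ := hz
      refine ⟨x' + z', I.add_mem hx' hz', ?_⟩
      have := Ideal.add_mem _ hx hz
      rw [map_add]; convert this using 1; ring
    | smul a x hx0 hx =>
      obtain ⟨x', hx', hx⟩ := hx
      obtain ⟨k, hk⟩ := hsurj n a
      refine ⟨k * x', I.mul_mem_left _ hx', ?_⟩
      have : a • x - ψ (k * x') = (a - ψ k) * ψ x' + a * (x - ψ x') := by
        rw [map_mul, smul_eq_mul]; ring
      rw [this]
      exact Ideal.add_mem _ (Ideal.mul_mem_right _ _ hk) (Ideal.mul_mem_left _ _ hx)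
  set N := mdeg s + 1 with hN
  obtain ⟨r', hr'⟩ := hsurj N r
  have hNN : (NN y u s).map ψ = NN Y u s := by
    rw [← NN_map, hy]; congr 1; funext i; exact hu i
  have hmm : ψ (monomial y u s) = monomial Y u s := by
    rw [← monomial_map, hy]; congr 1; funext i; exact hu i
  have h1 : ψ (r' * monomial y u s) ∈ (NN y u s).map ψ := by
    rw [hNN, map_mul, hmm]
    have : ψ r' * monomial Y u s = r * monomial Y u s - (r - ψ r') * monomial Y u s := by ring
    rw [this]
    refine Ideal.sub_mem _ hr (Ideal.mul_mem_right _ _ ?_)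
    refine pow_le_NN Y u s (Nat.lt_succ_self _) ?_
    rw [hMY]; exact hr'
  obtain ⟨a, ha, h2⟩ := hlift _ N _ h1
  rw [← map_sub] at h2
  have h3 := hinj _ _ h2
  rw [← hM] at h3
  have h4 := Ideal.add_mem _ (pow_le_NN y u s (Nat.lt_succ_self _) h3) ha
  rw [sub_add_cancel] at h4
  have h5 : r' ∈ maximalIdeal R := hI s r' h4
  have h6 : ψ r' ∈ maximalIdeal R := by rw [← hmap]; exact Ideal.mem_map_of_mem _ h5
  have h7 : r ∈ maximalIdeal R := by
    have := Ideal.add_mem _ (Ideal.pow_le_self (Nat.succ_ne_zero _) hr') h6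
    rwa [sub_add_cancel] at this
  exact h7 hru

structure Setup [IsLocalRing R] (p : ℕ) (y : R) (u : Fin 3 → R) : Prop where
  prime : p.Prime
  u0 : u 0 = p
  hM : Ideal.span (insert y (Set.range u)) = maximalIdeal R
  hint : ∀ r : R, ∃ n : ℤ, r - n ∈ maximalIdeal R
  hind : ∀ Y, Ideal.span (insert Y (Set.range u)) = maximalIdeal R → Indep Y u

lemma setup_loc (p : ℕ) (hp : p.Prime) (P : Ideal AA) [P.IsPrime]
    (R : Type u) [CommRing R] [IsLocalRing R] [IsNoetherianRing R] [Algebra AA R]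
    [IsLocalization.AtPrime R P]
    (hP : P = Ideal.span {(p : AA), Polynomial.C (MvPolynomial.X 0),
    Polynomial.C (MvPolynomial.X 1), Polynomial.X}) : Setup p (yl R) (ull p R) where
  prime := hp
  u0 := by simp [ull, uu]
  hM := maxl p P R hP
  hint := exists_int p P R hP hp
  hind := by
    intro Y hY
    obtain ⟨ψ, h1, h2⟩ := exists_endo p P R hP Y (by
      rw [← hY]; exact Ideal.subset_span (Set.mem_insert _ _))
    exact indep_endo p hp.pos (p_mem p P R hP) (exists_int p P R hP hp) (maxl p P R hP) hY
      (indep_std p P R hP hp) ψ h1 h2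

lemma height_P (p : ℕ) (hp : p.Prime) (P : Ideal AA) [P.IsPrime]
    (hP : P = Ideal.span {(p : AA), Polynomial.C (MvPolynomial.X 0),
    Polynomial.C (MvPolynomial.X 1), Polynomial.X}) : P.height = 4 := by
  apply le_antisymm
  · classical
    have h := Ideal.height_le_card_of_mem_minimalPrimes_span (p := P)
      (s := {(p : AA), Polynomial.C (MvPolynomial.X 0),
        Polynomial.C (MvPolynomial.X 1), Polynomial.X}) (Set.toFinite _) (by
        rw [← hP, Ideal.minimalPrimes_eq_subsingleton_self]; rfl)
    refine h.trans ?_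
    have h1 := Set.ncard_insert_le (p : AA) {Polynomial.C (MvPolynomial.X 0),
      Polynomial.C (MvPolynomial.X 1), Polynomial.X}
    have h2 := Set.ncard_insert_le (Polynomial.C (MvPolynomial.X 0) : AA)
      {Polynomial.C (MvPolynomial.X 1), Polynomial.X}
    have h3 := Set.ncard_insert_le (Polynomial.C (MvPolynomial.X 1) : AA) {Polynomial.X}
    have h4 := Set.ncard_singleton (Polynomial.X : AA)
    exact_mod_cast (by omega : _ ≤ 4)
  · let f1 : AA →+* MvPolynomial (Fin 2) ℤ := Polynomial.constantCoeff
    let f2 : AA →+* MvPolynomial (Fin 2) ℤ :=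
      (MvPolynomial.eval₂Hom MvPolynomial.C ![0, MvPolynomial.X 1]).comp f1
    have e1 : (⊥ : Ideal AA) < RingHom.ker f1 := by
      refine lt_of_le_of_ne bot_le fun h => ?_
      have : (Polynomial.X : AA) ∈ (⊥ : Ideal AA) := by rw [h]; simp [f1, RingHom.mem_ker]
      exact Polynomial.X_ne_zero this
    have e2 : RingHom.ker f1 < RingHom.ker f2 := by
      refine lt_of_le_of_ne ?_ fun h => ?_
      · intro x hx
        rw [RingHom.mem_ker] at hx ⊢
        simp [f2, hx]
      · have : (Polynomial.C (MvPolynomial.X 0) : AA) ∈ RingHom.ker f1 := by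
          rw [h]; simp [f1, f2, RingHom.mem_ker]
        rw [RingHom.mem_ker] at this
        simp [f1] at this
    have e3 : RingHom.ker f2 < RingHom.ker phi := by
      refine lt_of_le_of_ne ?_ fun h => ?_
      · intro x hx
        rw [RingHom.mem_ker] at hx ⊢
        have h0 : phi = MvPolynomial.constantCoeff.comp f2 := by
          apply Polynomial.ringHom_ext'
          · apply MvPolynomial.ringHom_ext'
            · exact RingHom.ext_int _ _
            · intro i
              fin_cases i <;> simp [phi, f2, f1]
          · simp [phi, f2, f1]
        rw [h0, RingHom.comp_apply, hx, map_zero]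
      · have : (Polynomial.C (MvPolynomial.X 1) : AA) ∈ RingHom.ker f2 := by
          rw [h]; simp [phi, RingHom.mem_ker]
        rw [RingHom.mem_ker] at this
        simp [f1, f2] at this
    have e4 : RingHom.ker phi < P := by
      refine lt_of_le_of_ne ?_ fun h => ?_
      · intro x hx
        rw [RingHom.mem_ker] at hx
        exact mem_P_of_dvd p P hP x (by rw [hx]; exact dvd_zero _)
      · have : (p : AA) ∈ RingHom.ker phi := by
          rw [h, hP]; exact Ideal.subset_span (by simp)
        rw [RingHom.mem_ker, map_natCast] at this
        exact hp.ne_zero (by exact_mod_cast this)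
    have i1 : (RingHom.ker f1).IsPrime := RingHom.ker_isPrime _
    have i2 : (RingHom.ker f2).IsPrime := RingHom.ker_isPrime _
    have i3 : (RingHom.ker phi).IsPrime := RingHom.ker_isPrime _
    have g1 := Ideal.height_add_one_le_of_lt_of_isPrime e1
    have g2 := Ideal.height_add_one_le_of_lt_of_isPrime e2
    have g3 := Ideal.height_add_one_le_of_lt_of_isPrime e3
    have g4 := Ideal.height_add_one_le_of_lt_of_isPrime e4
    have g0 : (0 : ℕ∞) ≤ (⊥ : Ideal AA).height := bot_le
    calc (4 : ℕ∞) = 0 + 1 + 1 + 1 + 1 := by norm_num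
      _ ≤ (⊥ : Ideal AA).height + 1 + 1 + 1 + 1 := by gcongr
      _ ≤ (RingHom.ker f1).height + 1 + 1 + 1 := by gcongr
      _ ≤ (RingHom.ker f2).height + 1 + 1 := by gcongr
      _ ≤ (RingHom.ker phi).height + 1 := by gcongr
      _ ≤ _ := g4
namespace Setup

variable [IsLocalRing R] {p : ℕ} {y : R} {u : Fin 3 → R}

lemma pM (h : Setup p y u) : (p : R) ∈ maximalIdeal R := by
  rw [← h.hM, ← h.u0]; exact Ideal.subset_span (Or.inr ⟨0, rfl⟩)

lemma int_unit (h : Setup p y u) (n : ℤ) (hn : ¬ (p : ℤ) ∣ n) : (n : R) ∉ maximalIdeal R := by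
  intro hnM
  obtain ⟨α, β, hab⟩ := ((Nat.prime_iff_prime_int.1 h.prime).coprime_iff_not_dvd).2 hn
  have hab' := congrArg (Int.cast (R := R)) hab
  push_cast at hab'
  have : (1 : R) ∈ maximalIdeal R := by
    rw [← hab']
    exact Ideal.add_mem _ (Ideal.mul_mem_left _ _ h.pM) (Ideal.mul_mem_left _ _ hnM)
  exact (Ideal.ne_top_iff_one _).1 Ideal.IsPrime.ne_top' this

lemma rep (h : Setup p y u) {Y : R} (hY : Ideal.span (insert Y (Set.range u)) = maximalIdeal R)
    (r : R) (hr : r ∈ maximalIdeal R) :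
    ∃ a b c d, r = Y * a + p * b + u 1 * c + u 2 * d := by
  rw [← hY] at hr
  induction hr using Submodule.span_induction with
  | mem x hx =>
    rcases hx with rfl | ⟨i, rfl⟩
    · exact ⟨1, 0, 0, 0, by ring⟩
    · fin_cases i
      · exact ⟨0, 1, 0, 0, by simp [h.u0]⟩
      · exact ⟨0, 0, 1, 0, by simp⟩
      · exact ⟨0, 0, 0, 1, by simp⟩
  | zero => exact ⟨0, 0, 0, 0, by ring⟩
  | add x z _ _ hx hz =>
    obtain ⟨a, b, c, d, rfl⟩ := hx
    obtain ⟨a', b', c', d', rfl⟩ := hz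
    exact ⟨a + a', b + b', c + c', d + d', by ring⟩
  | smul k x _ hx =>
    obtain ⟨a, b, c, d, rfl⟩ := hx
    exact ⟨k * a, k * b, k * c, k * d, by rw [smul_eq_mul]; ring⟩

lemma rep' (h : Setup p y u) {Y : R} (hY : Ideal.span (insert Y (Set.range u)) = maximalIdeal R)
    (r : R) : ∃ (n : ℤ) (a b c d : R), r = n + (Y * a + p * b + u 1 * c + u 2 * d) := by
  obtain ⟨n, hn⟩ := h.hint r
  obtain ⟨a, b, c, d, e⟩ := h.rep hY _ hn
  exact ⟨n, a, b, c, d, by rw [← e]; ring⟩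

lemma yM (h : Setup p y u) : y ∈ maximalIdeal R := by
  rw [← h.hM]; exact Ideal.subset_span (Set.mem_insert _ _)

lemma QF (h : Setup p y u) {Y : R} (hY : Ideal.span (insert Y (Set.range u)) = maximalIdeal R)
    (a b c e : ℕ) (q : R →+* R ⧸ NN Y u (![a, b, c], e))
    (hq : q = Ideal.Quotient.mk (NN Y u (![a, b, c], e))) :
    q Y ^ (e + 1) = 0 ∧ (p : R ⧸ NN Y u (![a, b, c], e)) ^ (a + 1) = 0 ∧ q (u 1) ^ (b + 1) = 0 ∧
    q (u 2) ^ (c + 1) = 0 ∧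
    (∀ r : R, q r * (q Y ^ e * (p ^ a * q (u 1) ^ b * q (u 2) ^ c)) = 0 → r ∈ maximalIdeal R) ∧
    (∀ n : ℤ, n * (q Y ^ e * (p ^ a * q (u 1) ^ b * q (u 2) ^ c)) = 0 → (p : ℤ) ∣ n) := by
  have key : ∀ r : R, q r * (q Y ^ e * (p ^ a * q (u 1) ^ b * q (u 2) ^ c)) = 0 →
      r ∈ maximalIdeal R := by
    intro r hr
    have : r * monomial Y u (![a, b, c], e) ∈ NN Y u (![a, b, c], e) := by
      rw [← Ideal.Quotient.eq_zero_iff_mem, ← hq, ← hr]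
      simp [monomial, Fin.prod_univ_three, h.u0]
    exact h.hind Y hY _ r this
  have hz : ∀ x ∈ NN Y u (![a, b, c], e), q x = 0 := by
    intro x hx; rw [hq]; exact Ideal.Quotient.eq_zero_iff_mem.2 hx
  refine ⟨?_, ?_, ?_, ?_, key, fun n hn => ?_⟩
  · rw [← map_pow]; exact hz _ (Ideal.subset_span (Set.mem_insert _ _))
  · have := hz _ (Ideal.subset_span (Or.inr ⟨0, rfl⟩))
    simpa [h.u0] using this
  · have := hz _ (Ideal.subset_span (Or.inr ⟨1, rfl⟩))
    simpa [h.u0] using this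
  · have := hz _ (Ideal.subset_span (Or.inr ⟨2, rfl⟩))
    simpa [h.u0] using this
  · by_contra hcon
    exact h.int_unit n hcon (key n (by rw [map_intCast]; exact hn))

lemma QE (h : Setup p y u) {Y : R} (hY : Ideal.span (insert Y (Set.range u)) = maximalIdeal R)
    (a b c e : ℕ) : ∃ (Q : Type u) (_ : CommRing Q) (q : R →+* Q),
    (∀ x ∈ NN Y u (![a, b, c], e), q x = 0) ∧
    q Y ^ (e + 1) = 0 ∧ (p : Q) ^ (a + 1) = 0 ∧ q (u 1) ^ (b + 1) = 0 ∧
    q (u 2) ^ (c + 1) = 0 ∧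
    (∀ r : R, q r * (q Y ^ e * (p ^ a * q (u 1) ^ b * q (u 2) ^ c)) = 0 → r ∈ maximalIdeal R) ∧
    (∀ n : ℤ, n * (q Y ^ e * (p ^ a * q (u 1) ^ b * q (u 2) ^ c)) = 0 → (p : ℤ) ∣ n) :=
  ⟨_, _, Ideal.Quotient.mk (NN Y u (![a, b, c], e)),
    fun _ hx => Ideal.Quotient.eq_zero_iff_mem.2 hx, h.QF hY a b c e _ rfl⟩

lemma ndvd_pow (h : Setup p y u) (n : ℤ) (hn : ¬ (p : ℤ) ∣ n) (k : ℕ) : ¬ (p : ℤ) ∣ n ^ k :=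
  fun hc => hn ((Nat.prime_iff_prime_int.1 h.prime).dvd_of_dvd_pow hc)

end Setup

lemma two_le_pow_zero {Q : Type*} [CommRing Q] {x : Q} {a b : ℕ} (hx : x ^ a = 0) (hab : a ≤ b) :
    x ^ b = 0 := by
  rw [← Nat.add_sub_cancel' hab, pow_add, hx, zero_mul]

/-- Frobenius modulo `p`. -/
lemma frob {Q : Type*} [CommRing Q] {p : ℕ} (hp : p.Prime) (t : Q) (ht : t * p = 0) (a b : Q) :
    t * (a + b) ^ p = t * a ^ p + t * b ^ p := by
  obtain ⟨r, hr⟩ := exists_add_pow_prime_eq hp a b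
  rw [hr]
  linear_combination (a * b * r) * ht

/-- first order -/
lemma first_ord {Q : Type*} [CommRing Q] (n : ℕ) (t a b : Q) (ht : t * b ^ 2 = 0) :
    t * (a + b) ^ n = t * a ^ n + t * (n * a ^ (n - 1) * b) := by
  obtain ⟨r, hr⟩ := Polynomial.powAddExpansion a b n
  rw [hr]
  linear_combination r * ht

lemma zero_ord {Q : Type*} [CommRing Q] (n : ℕ) (t a b : Q) (ht : t * b = 0) :
    t * (a + b) ^ n = t * a ^ n := by
  obtain ⟨r, hr⟩ := sub_dvd_pow_sub_pow (a + b) a n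
  have : (a + b) ^ n = a ^ n + b * r := by linear_combination hr
  rw [this]
  linear_combination r * ht

lemma int_fermat {p : ℕ} (hp : p.Prime) (n : ℤ) : (p : ℤ) ∣ n ^ p - n := by
  have := Fact.mk hp
  rw [← ZMod.intCast_zmod_eq_zero_iff_dvd]
  push_cast
  rw [ZMod.pow_card, sub_self]

lemma int_pow_sq {p : ℕ} (n m : ℤ) (h : (p : ℤ) ∣ n - m) : (p : ℤ) ^ 2 ∣ n ^ p - m ^ p := by
  obtain ⟨j, hj⟩ := h
  have hn : n = m + p * j := by linarith
  obtain ⟨r, hr⟩ := Polynomial.powAddExpansion m (p * j) p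
  rw [hn, hr]
  exact ⟨m ^ (p - 1) * j + r * j ^ 2, by ring⟩

lemma int_lift {p : ℕ} (hp : p.Prime) (n m : ℤ) (h : (p : ℤ) ∣ n ^ p - m) :
    (p : ℤ) ^ 2 ∣ n ^ p - m ^ p := by
  apply int_pow_sq
  have := dvd_sub h (int_fermat hp n)
  rwa [show n ^ p - m - (n ^ p - n) = n - m by ring] at this

section core

variable [IsLocalRing R] {p : ℕ} {y : R} {u : Fin 3 → R}

def ff (p : ℕ) (m : ℤ) (y : R) (u : Fin 3 → R) : R :=
  y ^ p - u 1 * u 2 ^ p - (m + u 2 ^ p) * (p : R) ^ p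

lemma core1 (h : Setup p y u) {Y : R} (hY : Ideal.span (insert Y (Set.range u)) = maximalIdeal R)
    (m : ℤ) : ff p m y u ∉ NN Y u (![0, 1, p], 0) := by
  intro hf
  obtain ⟨Q, _, q, hf0, hY0, hp0, hv, hw, -, hn⟩ := h.QE hY 0 1 p 0
  replace hf0 := hf0 _ hf
  obtain ⟨a, b, c, d, hyr⟩ := h.rep hY y h.yM
  obtain ⟨n, a', b', c', d', hdr⟩ := h.rep' hY d
  have hyq := congrArg q hyr
  have hdq := congrArg q hdr
  have h2 := h.prime.two_le
  clear hyr hdr hf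
  simp only [zero_add, pow_one, ff, map_sub, map_add, map_mul, map_pow, map_natCast, map_intCast,
    pow_zero, one_mul] at *
  generalize q y = y at *
  generalize q Y = Y at *
  generalize q (u 1) = v at *
  generalize q (u 2) = w at *
  generalize q d = d at *
  rw [hY0, hp0] at hyq hdq
  rw [hp0] at hf0
  have e1 := frob h.prime 1 (by simp [hp0]) (v * q c) (w * d)
  have e2 := frob h.prime 1 (by simp [hp0]) (n : Q) (v * q c' + w * q d')
  have e3 := frob h.prime 1 (by simp [hp0]) (v * q c') (w * q d')
  have hvp : v ^ p = 0 := two_le_pow_zero hv h2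
  have hwp : w ^ p * w ^ p = 0 := by
    rw [← pow_add]; exact two_le_pow_zero hw (by omega)
  simp only [one_mul, mul_pow, hvp, zero_mul, zero_add] at e1 e2 e3
  simp only [zero_mul, zero_add] at hyq hdq
  have ey : y ^ p = n ^ p * w ^ p := by
    rw [hyq, e1, hdq, e2, e3]
    linear_combination q d' ^ p * hwp
  have key : (n : Q) ^ p * w ^ p = v * w ^ p := by
    rw [ey, zero_pow h.prime.ne_zero] at hf0
    linear_combination hf0
  by_cases hpn : (p : ℤ) ∣ n
  · have h0 : (n : Q) = 0 := by
      obtain ⟨k, rfl⟩ := hpn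
      push_cast; rw [hp0, zero_mul]
    rw [h0, zero_pow h.prime.ne_zero, zero_mul] at key
    have := hn 1 (by rw [← key]; simp)
    exact h.prime.one_lt.ne' (by exact_mod_cast Int.eq_one_of_dvd_one (by positivity) this)
  · refine h.ndvd_pow n hpn p (hn (n ^ p) ?_)
    push_cast
    linear_combination v * key + w ^ p * hv

lemma coreA (h : Setup p y u) {Y : R} (hY : Ideal.span (insert Y (Set.range u)) = maximalIdeal R)
    (m : ℤ) (hm : ¬ (p : ℤ) ∣ m) : ff p m y u ∉ NN Y u (![p, 0, 0], 1) := by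
  intro hf
  obtain ⟨Q, _, q, hf0, hY0, hp0, hv, hw, hr, hn⟩ := h.QE hY p 0 0 1
  replace hf0 := hf0 _ hf
  obtain ⟨a, b, c, d, hyr⟩ := h.rep hY y h.yM
  obtain ⟨n, a', b', c', d', hbr⟩ := h.rep' hY b
  obtain ⟨α, β, γ, δ, hYr⟩ := h.rep h.hM Y (by
    rw [← hY]; exact Ideal.subset_span (Set.mem_insert _ _))
  have hyq := congrArg q hyr
  have hbq := congrArg q hbr
  have hYq := congrArg q hYr
  have h2 := h.prime.two_le
  clear hyr hbr hf hYr
  obtain ⟨k, rfl⟩ : ∃ k, p = k + 1 := ⟨p - 1, by omega⟩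
  simp only [zero_add, pow_one, ff, map_sub, map_add, map_mul, map_pow, map_natCast, map_intCast,
    pow_zero, one_mul, mul_one, map_one] at *
  generalize q y = y at *
  generalize q Y = Y at *
  rw [hv, hw] at hyq hbq hYq hf0
  generalize q b = b at *
  generalize hP : ((k + 1 : ℕ) : Q) = P at *
  have hP0 : P ^ (k + 1) * P = 0 := by rw [← pow_succ]; exact hp0
  have ey : y = P * (n + P * q b') + Y * (q a + P * q a') := by
    rw [hyq, hbq]; ring
  have e1 := first_ord (k + 1) 1 (P * (n + P * q b')) (Y * (q a + P * q a'))
    (by linear_combination (q a + P * q a') ^ 2 * hY0)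
  have e2 := zero_ord (k + 1) (P ^ (k + 1)) n (P * q b') (by linear_combination q b' * hP0)
  have e3 := zero_ord k (P ^ (k + 1)) n (P * q b') (by linear_combination q b' * hP0)
  simp only [one_mul, mul_pow, Nat.add_sub_cancel, hP] at e1
  have eyp : y ^ (k + 1) = P ^ (k + 1) * n ^ (k + 1) + P ^ (k + 1) * n ^ k * Y * q a := by
    rw [ey, e1]
    linear_combination e2 + (Y * (q a + P * q a')) * e3 + n ^ k * Y * q a' * hP0
  have key : P ^ (k + 1) * n ^ (k + 1) + P ^ (k + 1) * n ^ k * Y * q a = m * P ^ (k + 1) := by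
    rw [← eyp]
    linear_combination hf0
  have hd : ((k + 1 : ℕ) : ℤ) ∣ n ^ (k + 1) - m := by
    apply hn
    push_cast
    linear_combination Y * key - P ^ (k + 1) * n ^ k * q a * hY0
  have hpn : ¬ ((k + 1 : ℕ) : ℤ) ∣ n := by
    intro hc
    apply hm
    have := dvd_sub (hc.trans (dvd_pow_self n (Nat.succ_ne_zero k))) hd
    simpa using this
  have hz : P ^ (k + 1) * ((n : Q) ^ (k + 1) - m) = 0 := by
    obtain ⟨j, hj⟩ := hd
    have := congrArg (Int.cast (R := Q)) hj
    push_cast at this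
    have hPc : (k : Q) + 1 = P := by rw [← hP]; push_cast; rfl
    linear_combination P ^ (k + 1) * this + P ^ (k + 1) * j * hPc + j * hP0
  have haM : a ∈ maximalIdeal R := by
    have := hr (n ^ k * a) (by
      rw [map_mul, map_pow, map_intCast]
      linear_combination key - hz)
    rcases (maximalIdeal.isMaximal R).isPrime.mem_or_mem this with h1 | h1
    · exact absurd (by exact_mod_cast h1) (h.int_unit _ (h.ndvd_pow n hpn k))
    · exact h1
  have hfin := hr (1 - α * a) (by
    rw [map_sub, map_mul, map_one]
    linear_combination P ^ (k + 1) * hYq + P ^ (k + 1) * q α * ey +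
      (q β + q α * (n + P * q b') + q α * Y * q a') * hP0)
  have : (1 : R) ∈ maximalIdeal R := by
    have := Ideal.add_mem _ hfin (Ideal.mul_mem_left _ α haM)
    rwa [sub_add_cancel] at this
  exact (Ideal.ne_top_iff_one _).1 Ideal.IsPrime.ne_top' this

lemma coreB (h : Setup p y u) {Y : R} (hY : Ideal.span (insert Y (Set.range u)) = maximalIdeal R)
    (m : ℤ) (hm : ¬ (p : ℤ) ^ 2 ∣ m ^ p - m) : ff p m y u ∉ NN Y u (![p + 1, 0, 0], 0) := by
  intro hf
  obtain ⟨Q, _, q, hf0, hY0, hp0, hv, hw, hr, hn⟩ := h.QE hY (p + 1) 0 0 0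
  replace hf0 := hf0 _ hf
  obtain ⟨a, b, c, d, hyr⟩ := h.rep hY y h.yM
  obtain ⟨n, a', b', c', d', hbr⟩ := h.rep' hY b
  have hyq := congrArg q hyr
  have hbq := congrArg q hbr
  have h2 := h.prime.two_le
  clear hyr hbr hf
  have hwp : q (u 2) ^ p = 0 := two_le_pow_zero hw h.prime.pos
  simp only [zero_add, pow_one, ff, map_sub, map_add, map_mul, map_pow, map_natCast, map_intCast,
    pow_zero, one_mul, mul_one, hwp] at *
  rw [hv, hw, hY0] at hyq hbq
  rw [hv] at hf0
  generalize q y = y at *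
  generalize q b = b at *
  have hpp : (p : Q) ^ p * p ^ 2 = 0 := by rw [← hp0]; ring
  have e1 := first_ord p ((p : Q) ^ p) n (p * q b') (by linear_combination q b' ^ 2 * hpp)
  have ey : y ^ p = (p : Q) ^ p * n ^ p := by
    rw [hyq, hbq]
    simp only [zero_mul, zero_add, add_zero, mul_pow]
    rw [e1]
    linear_combination n ^ (p - 1) * q b' * hpp
  have key : (p : Q) ^ p * (n ^ p - m) = 0 := by linear_combination hf0 - ey
  have hd : (p : ℤ) ∣ n ^ p - m := hn _ (by push_cast; linear_combination p * key)
  obtain ⟨j, hj⟩ := hd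
  have hj' := congrArg (Int.cast (R := Q)) hj
  push_cast at hj'
  have hd2 : (p : ℤ) ∣ j := hn _ (by linear_combination key - (p : Q) ^ p * hj')
  apply hm
  have h3 : (p : ℤ) ^ 2 ∣ n ^ p - m := by
    rw [hj, sq]; exact mul_dvd_mul_left _ hd2
  have h4 := int_lift h.prime n m ⟨j, hj⟩
  have := dvd_sub h3 h4
  rwa [show n ^ p - m - (n ^ p - m ^ p) = m ^ p - m by ring] at this

lemma core2a (h : Setup p y u) {Y : R} (hY : Ideal.span (insert Y (Set.range u)) = maximalIdeal R)
    (m : ℤ) (hf : ff p m y u ∈ NN Y u (![0, 0, p ^ 2], 0)) (k : ℕ) (hk : k ≤ p) :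
    ∃ a b c d : R, y = Y * a + p * b + u 1 * c + u 2 ^ (k + 1) * d := by
  induction k with
  | zero =>
    obtain ⟨a, b, c, d, e⟩ := h.rep hY y h.yM
    exact ⟨a, b, c, d, by simpa using e⟩
  | succ k ih =>
    obtain ⟨a, b, c, d, hy⟩ := ih (by omega)
    obtain ⟨n, a', b', c', d', hd⟩ := h.rep' hY d
    by_cases hpn : (p : ℤ) ∣ n
    · obtain ⟨j, rfl⟩ := hpn
      refine ⟨a + u 2 ^ (k + 1) * a', b + u 2 ^ (k + 1) * (j + b'), c + u 2 ^ (k + 1) * c', d', ?_⟩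
      rw [hy, hd]
      push_cast
      ring
    · exfalso
      obtain ⟨Q, _, q, hf0, hY0, hp0, hv, hw, hr, hn⟩ := h.QE hY 0 0 (p ^ 2) 0
      replace hf0 := hf0 _ hf
      have hyq := congrArg q hy
      have hdq := congrArg q hd
      clear hf hy hd
      simp only [zero_add, pow_one, ff, map_sub, map_add, map_mul, map_pow, map_natCast,
        map_intCast, pow_zero, one_mul, mul_one] at *
      rw [hp0, hv, hY0] at hyq hdq
      rw [hp0, hv, zero_pow h.prime.ne_zero] at hf0
      generalize q y = y at *
      generalize q (u 2) = w at *
      have e1 := frob h.prime 1 (by simp [hp0]) (n : Q) (w * q d')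
      have ey : y ^ p = w ^ ((k + 1) * p) * (n ^ p + w ^ p * q d' ^ p) := by
        rw [hyq, hdq]
        simp only [zero_mul, zero_add, mul_pow, one_mul] at e1 ⊢
        rw [e1, ← pow_mul]
      refine h.ndvd_pow n hpn p (hn (n ^ p) ?_)
      push_cast
      have hle : (k + 1) * p ≤ p ^ 2 := by rw [sq]; gcongr
      have h1 : w ^ (p ^ 2 - (k + 1) * p) * w ^ ((k + 1) * p) = w ^ p ^ 2 := by
        rw [← pow_add, Nat.sub_add_cancel hle]
      have h2 : w ^ p ^ 2 * w ^ p = 0 := by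
        rw [← pow_add]; exact two_le_pow_zero hw (by have := h.prime.pos; omega)
      linear_combination w ^ (p ^ 2 - (k + 1) * p) * hf0 - w ^ (p ^ 2 - (k + 1) * p) * ey -
        (n ^ p + w ^ p * q d' ^ p) * h1 - q d' ^ p * h2

lemma core2 (h : Setup p y u) {Y : R} (hY : Ideal.span (insert Y (Set.range u)) = maximalIdeal R)
    (m : ℤ) (hm : ¬ (p : ℤ) ∣ m) (hm2 : (p : ℤ) ^ 2 ∣ m ^ p - m)
    (hf1 : ff p m y u ∈ NN Y u (![0, 0, p ^ 2], 0))
    (hf2 : ff p m y u ∈ NN Y u (![p, 0, p], 0))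
    (hf3 : ff p m y u ∈ NN Y u (![p + 1, 0, 1], 0)) : False := by
  obtain ⟨a, g, c, d, hy⟩ := core2a h hY m hf1 p le_rfl
  obtain ⟨n, a1, b1, c1, g2, hg⟩ := h.rep' hY g
  obtain ⟨k, a2, b2, c2, d2, hg2⟩ := h.rep' hY g2
  have hpp := h.prime.two_le
  have hstep : (p : ℤ) ∣ n ^ p - m ∧ (p : ℤ) ∣ k ^ p - 1 := by
    obtain ⟨Q, _, q, hf0, hY0, hp0, hv, hw, hr, hn⟩ := h.QE hY p 0 p 0
    replace hf0 := hf0 _ hf2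
    have hyq := congrArg q hy
    have hgq := congrArg q hg
    have hg2q := congrArg q hg2
    clear hf1 hf2 hf3 hy hg hg2
    simp only [zero_add, pow_one, ff, map_sub, map_add, map_mul, map_pow, map_natCast,
      map_intCast, pow_zero, one_mul, mul_one] at *
    rw [hv, hY0] at hgq hg2q
    rw [hv, hY0, hw] at hyq
    rw [hv] at hf0
    generalize q y = y at *
    generalize q (u 2) = w at *
    generalize q g = g at *
    generalize q g2 = g2 at *
    have hP : (p : Q) ^ p * p = 0 := by rw [← pow_succ]; exact hp0
    have hww : w ^ p * w ^ p = 0 := by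
      rw [← pow_add]; exact two_le_pow_zero hw (by omega)
    have eg : g = n + (k * w + q d2 * w ^ 2) + p * (q b1 + w * q b2) := by
      rw [hgq, hg2q]; ring
    have ey : y = p * g := by rw [hyq]; ring
    have e1 := zero_ord p ((p : Q) ^ p) (n + (k * w + q d2 * w ^ 2)) (p * (q b1 + w * q b2))
      (by linear_combination (q b1 + w * q b2) * hP)
    have e2 := frob h.prime ((p : Q) ^ p) hP n (k * w + q d2 * w ^ 2)
    have e3 := frob h.prime ((p : Q) ^ p) hP (k * w) (q d2 * w ^ 2)
    have eyp : y ^ p = (p : Q) ^ p * n ^ p + (p : Q) ^ p * (k ^ p * w ^ p) := by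
      rw [ey, mul_pow, eg, e1, e2, e3, mul_pow, mul_pow]
      have : (w ^ 2) ^ p = 0 := by rw [← hww]; ring
      rw [this]; ring
    have key : (p : Q) ^ p * (n ^ p - m) + p ^ p * w ^ p * (k ^ p - 1) = 0 := by
      linear_combination hf0 - eyp
    have hd1 : (p : ℤ) ∣ n ^ p - m := hn _ (by
      push_cast
      linear_combination w ^ p * key - p ^ p * (k ^ p - 1) * hww)
    refine ⟨hd1, hn _ ?_⟩
    obtain ⟨j, hj⟩ := hd1
    have hj' := congrArg (Int.cast (R := Q)) hj
    push_cast at hj' ⊢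
    linear_combination key - p ^ p * hj' - j * hP
  obtain ⟨hd1, hd2⟩ := hstep
  have hpn : ¬ (p : ℤ) ∣ n := by
    intro hc
    apply hm
    have := dvd_sub (hc.trans (dvd_pow_self n h.prime.ne_zero)) hd1
    simpa using this
  have hpk : ¬ (p : ℤ) ∣ k := by
    intro hc
    have := dvd_sub (hc.trans (dvd_pow_self k h.prime.ne_zero)) hd2
    simp only [sub_sub_cancel] at this
    exact h.prime.one_lt.ne' (by exact_mod_cast Int.eq_one_of_dvd_one (by positivity) this)
  have hd3 : (p : ℤ) ^ 2 ∣ n ^ p - m := by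
    have := dvd_add (int_lift h.prime n m hd1) hm2
    rwa [show n ^ p - m ^ p + (m ^ p - m) = n ^ p - m by ring] at this
  obtain ⟨Q, _, q, hf0, hY0, hp0, hv, hw, hr, hn⟩ := h.QE hY (p + 1) 0 1 0
  replace hf0 := hf0 _ hf3
  have hyq := congrArg q hy
  have hgq := congrArg q hg
  have hg2q := congrArg q hg2
  clear hf1 hf2 hf3 hy hg hg2
  have hwp1 : q (u 2) ^ (p + 1) = 0 := two_le_pow_zero hw (by omega)
  have hwp : q (u 2) ^ p = 0 := two_le_pow_zero hw (by omega)
  simp only [zero_add, pow_one, ff, map_sub, map_add, map_mul, map_pow, map_natCast,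
    map_intCast, pow_zero, one_mul, mul_one, hwp] at *
  rw [hv, hY0] at hgq hg2q
  rw [hv, hY0, hwp1] at hyq
  generalize q y = y at *
  generalize q (u 2) = w at *
  generalize q g = g at *
  generalize q g2 = g2 at *
  have hw2 : w ^ 2 = 0 := hw
  have hP : (p : Q) ^ p * p ^ 2 = 0 := by rw [← hp0]; ring
  have eg : g = n + k * w + p * (q b1 + w * q b2) := by
    rw [hgq, hg2q]; linear_combination q d2 * hw2
  have ey : y = p * g := by rw [hyq]; ring
  have e1 := first_ord p ((p : Q) ^ p) (n + k * w) (p * (q b1 + w * q b2))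
    (by linear_combination (q b1 + w * q b2) ^ 2 * hP)
  have e2 := first_ord p ((p : Q) ^ p) n (k * w) (by linear_combination p ^ p * k ^ 2 * hw2)
  have eyp : y ^ p = (p : Q) ^ p * n ^ p + (p : Q) ^ (p + 1) * (n ^ (p - 1) * k * w) := by
    rw [ey, mul_pow, eg, e1, e2]
    linear_combination (n + k * w) ^ (p - 1) * (q b1 + w * q b2) * hP
  obtain ⟨j, hj⟩ := hd3
  have hj' := congrArg (Int.cast (R := Q)) hj
  push_cast at hj'
  have hfin : (p : ℤ) ∣ n ^ (p - 1) * k := hn _ (by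
    push_cast
    linear_combination hf0 - eyp - p ^ p * hj' - j * hP)
  rcases (Nat.prime_iff_prime_int.1 h.prime).dvd_or_dvd hfin with h1 | h1
  · exact h.ndvd_pow n hpn _ h1
  · exact hpk h1

end core
def V1 (p : ℕ) : Set (Fin 3 → ℝ) := {![0, 1 / (p : ℝ), 1], ![1 + 1 / (p : ℝ), 0, 0]}
def V2 (p : ℕ) : Set (Fin 3 → ℝ) := {![0, 1 / (p : ℝ), 1], ![1 + 1 / ((p : ℝ) - 1), 0, 0],
          ![1 + 1 / (p : ℝ), 0, 1 / (p : ℝ)]}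

lemma low1 {S : Type*} [CommRing S] (F Y : S) (U : Fin 3 → S) (p : ℕ) (hp : p.Prime)
    (hex : ∃ c, IsUnitExpansion F Y U c)
    (h1 : F ∉ NN Y U (![0, 1, p], 0)) (h2 : F ∉ NN Y U (![p + 1, 0, 0], 0)) :
    V1 p ⊆ DeltaOf F Y U p := by
  have hp0 : (p : ℝ) ≠ 0 := by exact_mod_cast hp.ne_zero
  have e1 := proj_mem_DeltaOf hex _ hp.pos h1
  have e2 := proj_mem_DeltaOf hex _ hp.pos h2
  rintro x (rfl | rfl)
  · convert e1 using 1
    ext i; fin_cases i <;> simp [projPoint, hp0]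
  · convert e2 using 1
    ext i; fin_cases i <;> simp [projPoint]
    field_simp

lemma low2 {S : Type*} [CommRing S] (F Y : S) (U : Fin 3 → S) (p : ℕ) (hp : p.Prime)
    (hex : ∃ c, IsUnitExpansion F Y U c)
    (h1 : F ∉ NN Y U (![0, 1, p], 0)) (h2 : F ∉ NN Y U (![p, 0, 0], 1))
    (h3 : F ∈ NN Y U (![0, 0, p ^ 2], 0) → F ∈ NN Y U (![p, 0, p], 0) →
      F ∈ NN Y U (![p + 1, 0, 1], 0) → False) :
    V2 p ⊆ DeltaOf F Y U p := by
  have hp0 : (p : ℝ) ≠ 0 := by exact_mod_cast hp.ne_zero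
  have hp2 : (2 : ℝ) ≤ p := by exact_mod_cast hp.two_le
  have hp1 : (p : ℝ) - 1 ≠ 0 := by linarith
  have hpp : (0 : ℝ) < p := by linarith
  have e1 := proj_mem_DeltaOf hex _ hp.pos h1
  have e2 := proj_mem_DeltaOf hex _ hp.one_lt h2
  have hconv : Convex ℝ (DeltaOf F Y U p) := (isFSubset_DeltaOf F Y U p).2.2.1
  rintro x (rfl | rfl | rfl)
  · convert e1 using 1
    ext i; fin_cases i <;> simp [projPoint, hp0]
  · convert e2 using 1
    ext i; fin_cases i <;> simp [projPoint]
    field_simp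
    ring
  · by_cases a1 : F ∈ NN Y U (![0, 0, p ^ 2], 0)
    · by_cases a2 : F ∈ NN Y U (![p, 0, p], 0)
      · have a3 : F ∉ NN Y U (![p + 1, 0, 1], 0) := fun a3 => h3 a1 a2 a3
        have e3 := proj_mem_DeltaOf hex _ hp.pos a3
        convert e3 using 1
        ext i; fin_cases i <;> simp [projPoint]
        field_simp
      · have e3 := proj_mem_DeltaOf hex _ hp.pos a2
        have hpi : 1 / (p : ℝ) ≤ 1 := by rw [div_le_one hpp]; linarith
        convert hconv e3 e2 (a := 1 / (p : ℝ)) (b := 1 - 1 / (p : ℝ)) (by positivity)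
          (by linarith) (by ring) using 1
        ext i; fin_cases i <;> simp [projPoint]
        · field_simp
          ring
        · field_simp
    · have e3 := proj_mem_DeltaOf hex _ hp.pos a1
      have hpi : 1 / (p : ℝ) ^ 2 ≤ 1 := by rw [div_le_one (by positivity)]; nlinarith
      convert hconv e3 e2 (a := 1 / (p : ℝ) ^ 2) (b := 1 - 1 / (p : ℝ) ^ 2) (by positivity)
          (by linarith) (by ring) using 1
      ext i; fin_cases i <;> simp [projPoint]
      · field_simp
        ring
      · field_simp
lemma transfer {d : ℕ} [IsLocalRing R] [IsNoetherianRing R] (u : Fin d → R) (yh : Completion R)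
    (hy : IsRSPhat R yh u) (N : ℕ) (hN : 2 ≤ N) :
    ∃ Y, Ideal.span (insert Y (Set.range u)) = maximalIdeal R ∧
      AdicCompletion.evalₐ (maximalIdeal R) N yh = Ideal.Quotient.mk _ Y ∧
      ∀ s, mdeg s < N → ∀ rh r, AdicCompletion.evalₐ (maximalIdeal R) N rh = Ideal.Quotient.mk _ r →
        rh ∈ NN yh (fun i => cmpl (u i)) s → r ∈ NN Y u s := by
  obtain ⟨Y, hY⟩ := Ideal.Quotient.mk_surjective (AdicCompletion.evalₐ (maximalIdeal R) N yh)
  set φ : Completion R →+* R ⧸ maximalIdeal R ^ N :=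
    (AdicCompletion.evalₐ (maximalIdeal R) N : Completion R →+* R ⧸ maximalIdeal R ^ N) with hφ
  have hφc : ∀ x : R, φ (cmpl x) = Ideal.Quotient.mk (maximalIdeal R ^ N) x := fun x =>
    (AdicCompletion.evalₐ (maximalIdeal R) N).commutes x
  have hφy : φ yh = Ideal.Quotient.mk _ Y := hY.symm
  have hle : maximalIdeal R ^ N ≤ maximalIdeal R • maximalIdeal R := by
    rw [smul_eq_mul, ← pow_two]; exact Ideal.pow_le_pow_right hN
  have hle' : maximalIdeal R ^ N ≤ maximalIdeal R := Ideal.pow_le_self (by omega)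
  have hcomp : φ.comp (cmpl (R := R)) = Ideal.Quotient.mk (maximalIdeal R ^ N) :=
    RingHom.ext hφc
  have hspan : Ideal.span (insert Y (Set.range u)) ⊔ maximalIdeal R ^ N = maximalIdeal R := by
    have h1 := congrArg (Ideal.map φ) hy
    rw [Ideal.map_map, hcomp, Ideal.map_span, Set.image_insert_eq, ← Set.range_comp, hφy] at h1
    have h2 : (φ ∘ fun i => cmpl (u i)) = (Ideal.Quotient.mk (maximalIdeal R ^ N)) ∘ u :=
      funext fun i => hφc _
    rw [h2, Set.range_comp, ← Set.image_insert_eq, ← Ideal.map_span] at h1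
    have h3 := congrArg (Ideal.comap (Ideal.Quotient.mk (maximalIdeal R ^ N))) h1
    rw [Ideal.comap_map_of_surjective' _ Ideal.Quotient.mk_surjective,
      Ideal.comap_map_of_surjective' _ Ideal.Quotient.mk_surjective, Ideal.mk_ker] at h3
    rw [h3, sup_eq_left.2 hle']
  have hM : Ideal.span (insert Y (Set.range u)) = maximalIdeal R := by
    apply le_antisymm
    · rw [← hspan]; exact le_sup_left
    · refine Submodule.le_of_le_smul_of_le_jacobson_bot (IsNoetherian.noetherian _)
        (IsLocalRing.maximalIdeal_le_jacobson ⊥) ?_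
      conv_lhs => rw [← hspan]
      exact sup_le_sup_left hle _
  refine ⟨Y, hM, hY.symm, fun s hs rh r hr hmem => ?_⟩
  have h1 := Ideal.mem_map_of_mem φ hmem
  rw [← NN_map, hφy] at h1
  have h2 : (fun i => φ (cmpl (u i))) = fun i => Ideal.Quotient.mk (maximalIdeal R ^ N) (u i) :=
    funext fun i => hφc _
  rw [h2, NN_map, show φ rh = Ideal.Quotient.mk _ r from hr, Ideal.mem_quotient_iff_mem_sup] at h1
  have h3 : maximalIdeal R ^ N ≤ NN Y u s := by rw [← hM]; exact pow_le_NN Y u s hs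
  rwa [sup_eq_left.2 h3] at h1

lemma indep_hat [IsLocalRing R] [IsNoetherianRing R] {d : ℕ} {u : Fin d → R}
    (hind : ∀ Y, Ideal.span (insert Y (Set.range u)) = maximalIdeal R → Indep Y u)
    (yh : Completion R) (hy : IsRSPhat R yh u) : Indep yh (fun i => cmpl (u i)) := by
  intro s rh hmem hunit
  obtain ⟨Y, hM, hY, ht⟩ := transfer u yh hy (mdeg s + 2) (by omega)
  obtain ⟨r, hr⟩ := Ideal.Quotient.mk_surjective
    (AdicCompletion.evalₐ (maximalIdeal R) (mdeg s + 2) rh)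
  set φ : Completion R →+* R ⧸ maximalIdeal R ^ (mdeg s + 2) :=
    (AdicCompletion.evalₐ (maximalIdeal R) (mdeg s + 2) :
      Completion R →+* R ⧸ maximalIdeal R ^ (mdeg s + 2)) with hφ
  have hφc : ∀ x : R, φ (cmpl x) = Ideal.Quotient.mk (maximalIdeal R ^ (mdeg s + 2)) x := fun x =>
    (AdicCompletion.evalₐ (maximalIdeal R) (mdeg s + 2)).commutes x
  have hφy : φ yh = Ideal.Quotient.mk _ Y := hY
  have hφr : φ rh = Ideal.Quotient.mk _ r := hr.symm
  refine hind Y hM s r (ht s (by omega) _ _ ?_ hmem) ?_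
  · change φ _ = _
    rw [map_mul, map_mul, hφr, ← monomial_map, ← monomial_map, hφy]
    simp only [hφc]
  · by_contra hr'
    have h1 : r ∈ maximalIdeal R := hr'
    have h2 : IsUnit (Ideal.Quotient.mk (maximalIdeal R ^ (mdeg s + 2)) r) := by
      rw [← hφr]; exact hunit.map φ
    have h3 := h2.map (Ideal.Quotient.factor (Ideal.pow_le_self (by omega)) :
      R ⧸ maximalIdeal R ^ (mdeg s + 2) →+* R ⧸ maximalIdeal R)
    rw [Ideal.Quotient.factor_mk, Ideal.Quotient.eq_zero_iff_mem.2 h1] at h3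
    exact not_isUnit_zero h3

lemma exists_hat [IsLocalRing R] [IsNoetherianRing R] {d : ℕ} {u : Fin d → R}
    (hind : ∀ Y, Ideal.span (insert Y (Set.range u)) = maximalIdeal R → Indep Y u)
    (yh : Completion R) (hy : IsRSPhat R yh u) (f : Completion R) :
    ∃ c, IsUnitExpansion f yh (fun i => cmpl (u i)) c := by
  have hm := AdicCompletion.maximalIdeal_eq_map (R := R)
  have hc : IsAdicComplete (maximalIdeal (Completion R)) (Completion R) := inferInstance
  refine exists_expansion_complete (R := Completion R) ?_ (indep_hat hind yh hy)
  rw [hm]; exact hy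

lemma nmem_hat {d : ℕ} [IsLocalRing R] [IsNoetherianRing R] (u : Fin d → R) (yh : Completion R)
    (hy : IsRSPhat R yh u) (N : ℕ) (hN : 2 ≤ N) (f : R) :
    ∃ Y, Ideal.span (insert Y (Set.range u)) = maximalIdeal R ∧
      ∀ s, mdeg s < N → cmpl f ∈ NN yh (fun i => cmpl (u i)) s → f ∈ NN Y u s := by
  obtain ⟨Y, hM, -, ht⟩ := transfer u yh hy N hN
  exact ⟨Y, hM, fun s hs h => ht s hs _ _
    ((AdicCompletion.evalₐ (maximalIdeal R) N).commutes f) h⟩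
lemma mono3 (z : R) (u : Fin 3 → R) (a b c e : ℕ) :
    monomial z u (![a, b, c], e) = z ^ e * (u 0 ^ a * u 1 ^ b * u 2 ^ c) := by
  simp [monomial, Fin.prod_univ_three]

def T0 (p : ℕ) : Set ((Fin 3 → ℕ) × ℕ) :=
  {t | t = (![0, 0, 0], p) ∨ t = (![0, 1, p], 0) ∨ ∃ k, 1 ≤ k ∧ k < p ∧ t = (![k + 1, 0, 0], p - k)}

def T1 (p : ℕ) : Set ((Fin 3 → ℕ) × ℕ) := insert (![p + 1, 0, 0], 0) (T0 p)
def T2 (p : ℕ) : Set ((Fin 3 → ℕ) × ℕ) :=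
  insert (![p + 2, 0, 0], 0) (insert (![p + 1, 0, 1], 0) (T0 p))

lemma up_aux {p : ℕ} (hp : p.Prime) (m : ℤ) (y : R) (u : Fin 3 → R) (hu : u 0 = p) (I : Ideal R)
    (hI : ∀ t ∈ T0 p, monomial (y - (m + u 2) * p) u t ∈ I) :
    ff p m y u - ((m + u 2) ^ p - m - u 2 ^ p) * (p : R) ^ p ∈ I := by
  obtain ⟨z, hz⟩ : ∃ z, z = y - (m + u 2) * p := ⟨_, rfl⟩
  obtain ⟨w, hw⟩ : ∃ w, w = (m : R) + u 2 := ⟨_, rfl⟩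
  rw [← hz] at hI
  have h1 : z ^ p ∈ I := by
    have := hI _ (Or.inl rfl); rw [mono3] at this; simpa using this
  have h2 : u 1 * u 2 ^ p ∈ I := by
    have := hI _ (Or.inr (Or.inl rfl)); rw [mono3] at this; simpa using this
  have h3 : ∀ k, 1 ≤ k → k < p → z ^ (p - k) * (p : R) ^ (k + 1) ∈ I := by
    intro k hk hk'
    have := hI _ (Or.inr (Or.inr ⟨k, hk, hk', rfl⟩)); rw [mono3] at this; simpa [hu] using this
  have hy : y = z + w * p := by rw [hz, hw]; ring
  have key : y ^ p - (w * p) ^ p ∈ I := by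
    rw [hy, add_pow, Finset.sum_range_succ']
    simp only [pow_zero, one_mul, Nat.sub_zero, Nat.choose_zero_right, Nat.cast_one, mul_one,
      add_sub_cancel_right]
    refine Ideal.sum_mem _ fun i hi => ?_
    have hi := Finset.mem_range.1 hi
    by_cases hip : i + 1 = p
    · rw [hip]; exact Ideal.mul_mem_right _ _ (Ideal.mul_mem_right _ _ h1)
    · obtain ⟨c, hc⟩ := hp.dvd_choose_self (k := i + 1) (by omega) (by omega)
      have := h3 (p - (i + 1)) (by omega) (by omega)
      rw [Nat.sub_sub_self (by omega)] at this
      convert Ideal.mul_mem_left I (w ^ (p - (i + 1)) * c) this using 1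
      rw [hc]; push_cast; ring
  have e : ff p m y u - ((m + u 2) ^ p - m - u 2 ^ p) * (p : R) ^ p =
      (y ^ p - (w * p) ^ p) - u 1 * u 2 ^ p := by
    rw [ff, ← hw, mul_pow]; ring
  rw [e]; exact I.sub_mem key h2

lemma up1 {p : ℕ} (hp : p.Prime) (m : ℤ) (y : R) (u : Fin 3 → R) (hu : u 0 = p) :
    ff p m y u ∈ Ideal.span (monomial (y - (m + u 2) * p) u '' T1 p) := by
  have h0 := up_aux hp m y u hu (Ideal.span (monomial (y - (m + u 2) * p) u '' T1 p))
    fun t ht => Ideal.subset_span ⟨t, Or.inr ht, rfl⟩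
  have h1 : (p : R) ^ (p + 1) ∈ Ideal.span (monomial (y - (m + u 2) * p) u '' T1 p) :=
    Ideal.subset_span ⟨_, Or.inl rfl, by rw [mono3]; simp [hu]⟩
  obtain ⟨r, hr⟩ := exists_add_pow_prime_eq hp (m : R) (u 2)
  obtain ⟨j, hj⟩ := int_fermat hp m
  have hj' := congrArg (Int.cast (R := R)) hj
  push_cast at hj'
  convert Ideal.add_mem _ h0 (Ideal.mul_mem_left _ (j + m * u 2 * r) h1) using 1
  rw [hr]
  linear_combination (p : R) ^ p * hj'

lemma up2 {p : ℕ} (hp : p.Prime) (m : ℤ) (hm : (p : ℤ) ^ 2 ∣ m ^ p - m)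
    (y : R) (u : Fin 3 → R) (hu : u 0 = p) :
    ff p m y u ∈ Ideal.span (monomial (y - (m + u 2) * p) u '' T2 p) := by
  have h0 := up_aux hp m y u hu (Ideal.span (monomial (y - (m + u 2) * p) u '' T2 p))
    fun t ht => Ideal.subset_span ⟨t, Or.inr (Or.inr ht), rfl⟩
  have h1 : (p : R) ^ (p + 2) ∈ Ideal.span (monomial (y - (m + u 2) * p) u '' T2 p) :=
    Ideal.subset_span ⟨_, Or.inl rfl, by rw [mono3]; simp [hu]⟩
  have h2 : (p : R) ^ (p + 1) * u 2 ∈ Ideal.span (monomial (y - (m + u 2) * p) u '' T2 p) :=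
    Ideal.subset_span ⟨_, Or.inr (Or.inl rfl), by rw [mono3]; simp [hu]⟩
  obtain ⟨r, hr⟩ := exists_add_pow_prime_eq hp (m : R) (u 2)
  obtain ⟨j, hj⟩ := hm
  have hj' := congrArg (Int.cast (R := R)) hj
  push_cast at hj'
  convert Ideal.add_mem _ (Ideal.add_mem _ h0 (Ideal.mul_mem_left _ (j : R) h1))
    (Ideal.mul_mem_left _ (m * r) h2) using 1
  rw [hr]
  linear_combination (p : R) ^ p * hj'

lemma V1_orth (p : ℕ) : V1 p ⊆ orthant 3 := by
  rintro v (rfl | rfl) i <;> fin_cases i <;> simp <;> positivity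

lemma V2_orth (p : ℕ) (hp : 2 ≤ p) : V2 p ⊆ orthant 3 := by
  have : (0 : ℝ) ≤ (p : ℝ) - 1 := by
    have : (2 : ℝ) ≤ p := by exact_mod_cast hp
    linarith
  rintro v (rfl | rfl | rfl) i <;> fin_cases i <;> simp <;> positivity

lemma mem_axis {S : Set (Fin 3 → ℝ)} (hS : IsFSubset S) {a b : ℝ} (h : ![a, 0, 0] ∈ S)
    (hab : a ≤ b) : ![b, 0, 0] ∈ S := by
  have := hS.2.2.2 _ h ![b - a, 0, 0] (by intro i; fin_cases i <;> simp [hab])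
  convert this using 1
  ext i; fin_cases i <;> simp

lemma proj0 {p : ℕ} (hp : 2 ≤ p) {S : Set (Fin 3 → ℝ)} (hS : IsFSubset S)
    (h1 : ![0, 1 / (p : ℝ), 1] ∈ S) (h2 : ![1 + 1 / ((p : ℝ) - 1), 0, 0] ∈ S)
    (t) (ht : t ∈ T0 p) (htp : t.2 < p) : projPoint p t ∈ S := by
  have hp2 : (2 : ℝ) ≤ p := by exact_mod_cast hp
  have hp0 : (p : ℝ) ≠ 0 := by linarith
  rcases ht with rfl | rfl | ⟨k, hk, hkp, rfl⟩
  · simp at htp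
  · convert h1 using 1
    ext i; fin_cases i <;> simp [projPoint, hp0]
  · have hk1 : (1 : ℝ) ≤ k := by exact_mod_cast hk
    have hk2 : (k : ℝ) + 1 ≤ p := by exact_mod_cast hkp
    have := mem_axis hS h2 (b := 1 + 1 / (k : ℝ)) (by gcongr; linarith)
    convert this using 1
    ext i; fin_cases i <;> simp [projPoint, Nat.cast_sub hkp.le]
    field_simp

lemma proj1 {p : ℕ} (hp : 2 ≤ p) (t) (ht : t ∈ T1 p) (htp : t.2 < p) :
    projPoint p t ∈ smallestFSubset (V1 p) := by
  have hp2 : (2 : ℝ) ≤ p := by exact_mod_cast hp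
  have hp0 : (p : ℝ) ≠ 0 := by linarith
  have hS := isFSubset_smallest (V1_orth p)
  have a1 : ![0, 1 / (p : ℝ), 1] ∈ smallestFSubset (V1 p) := subset_smallest _ (Or.inl rfl)
  have a2 : ![1 + 1 / (p : ℝ), 0, 0] ∈ smallestFSubset (V1 p) := subset_smallest _ (Or.inr rfl)
  rcases ht with rfl | ht
  · convert a2 using 1
    ext i; fin_cases i <;> simp [projPoint]
    field_simp
  · refine proj0 hp hS a1 (mem_axis hS a2 ?_) t ht htp
    have : (0 : ℝ) < (p : ℝ) - 1 := by linarith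
    gcongr; linarith

lemma proj2 {p : ℕ} (hp : 2 ≤ p) (t) (ht : t ∈ T2 p) (htp : t.2 < p) :
    projPoint p t ∈ smallestFSubset (V2 p) := by
  have hp2 : (2 : ℝ) ≤ p := by exact_mod_cast hp
  have hp0 : (p : ℝ) ≠ 0 := by linarith
  have hS := isFSubset_smallest (V2_orth p hp)
  have a1 : ![0, 1 / (p : ℝ), 1] ∈ smallestFSubset (V2 p) := subset_smallest _ (Or.inl rfl)
  have a2 : ![1 + 1 / ((p : ℝ) - 1), 0, 0] ∈ smallestFSubset (V2 p) :=
    subset_smallest _ (Or.inr (Or.inl rfl))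
  have a3 : ![1 + 1 / (p : ℝ), 0, 1 / (p : ℝ)] ∈ smallestFSubset (V2 p) :=
    subset_smallest _ (Or.inr (Or.inr rfl))
  rcases ht with rfl | rfl | ht
  · have := mem_axis hS a2 (b := 1 + 2 / (p : ℝ)) (by
      have : (0 : ℝ) < (p : ℝ) - 1 := by linarith
      rw [add_le_add_iff_left, div_le_div_iff₀ this (by linarith)]
      linarith)
    convert this using 1
    ext i; fin_cases i <;> simp [projPoint]
    field_simp
  · convert a3 using 1
    ext i; fin_cases i <;> simp [projPoint]
    field_simp
  · exact proj0 hp hS a1 a2 t ht htp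
section fin

variable [IsLocalRing R] {p : ℕ} {y : R} {u : Fin 3 → R}

lemma span_z (h : Setup p y u) (w : R) :
    Ideal.span (insert (y - w * p) (Set.range u)) = maximalIdeal R := by
  have hu : ∀ z, (p : R) ∈ Ideal.span (insert z (Set.range u)) := fun z => by
    rw [← h.u0]; exact Ideal.subset_span (Or.inr ⟨0, rfl⟩)
  rw [← h.hM]
  apply le_antisymm <;> rw [Ideal.span_le] <;> rintro x (rfl | hx)
  · exact Ideal.sub_mem _ (Ideal.subset_span (Or.inl rfl)) (Ideal.mul_mem_left _ _ (hu _))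
  · exact Ideal.subset_span (Or.inr hx)
  · have := Ideal.add_mem _ (Ideal.subset_span (Set.mem_insert (x - w * p) (Set.range u)))
      (Ideal.mul_mem_left _ w (hu (x - w * p)))
    simpa using this
  · exact Ideal.subset_span (Or.inr hx)

lemma ordRes_ff (h : Setup p y u) (m : ℤ) : ordRes (ff p m y u) u = p := by
  have hp : (p : R) ∈ Ideal.span (Set.range u) := by
    rw [← h.u0]; exact Ideal.subset_span ⟨0, rfl⟩
  have h1 : u 1 ∈ Ideal.span (Set.range u) := Ideal.subset_span ⟨1, rfl⟩
  have hd : ff p m y u - y ^ p ∈ Ideal.span (Set.range u) := by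
    have : ff p m y u - y ^ p = -(u 2 ^ p * u 1 + (m + u 2 ^ p) * (p : R) ^ p) := by
      rw [ff]; ring
    rw [this]
    exact Ideal.neg_mem_iff _ |>.2 (Ideal.add_mem _ (Ideal.mul_mem_left _ _ h1)
      (Ideal.mul_mem_left _ _ (Ideal.pow_mem_of_mem _ hp _ h.prime.pos)))
  refine IsGreatest.csSup_eq ⟨?_, fun n hn => ?_⟩
  · change ff p m y u ∈ maximalIdeal R ^ p ⊔ Ideal.span (Set.range u)
    rw [← sub_add_cancel (ff p m y u) (y ^ p)]
    exact Ideal.add_mem _ (Ideal.mem_sup_right hd)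
      (Ideal.mem_sup_left (Ideal.pow_mem_pow h.yM _))
  · change ff p m y u ∈ maximalIdeal R ^ n ⊔ Ideal.span (Set.range u) at hn
    by_contra hlt
    have hle : maximalIdeal R ^ n ⊔ Ideal.span (Set.range u) ≤ NN y u (0, p) := by
      refine sup_le ?_ ?_
      · rw [← h.hM]; exact pow_le_NN y u _ (by simpa [mdeg] using hlt)
      · rw [Ideal.span_le]; rintro _ ⟨i, rfl⟩
        exact Ideal.subset_span (Or.inr ⟨i, by simp⟩)
    have hy : y ^ p ∈ NN y u (0, p) := by
      rw [← sub_sub_cancel (ff p m y u) (y ^ p)]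
      exact Ideal.sub_mem _ (hle hn) (hle (Ideal.mem_sup_right hd))
    exact h.hind y h.hM (0, p) 1 (by simpa [monomial] using hy) isUnit_one

variable [IsNoetherianRing R]

lemma lowhat1 (h : Setup p y u) (m : ℤ) (hm2 : ¬ (p : ℤ) ^ 2 ∣ m ^ p - m)
    (yh : Completion R) (hy : IsRSPhat R yh u) :
    V1 p ⊆ DeltaOf (cmpl (ff p m y u)) yh (fun i => cmpl (u i)) p := by
  obtain ⟨Y, hM, ht⟩ := nmem_hat u yh hy (p ^ 2 + 2 * p + 10) (by omega) (ff p m y u)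
  refine low1 _ _ _ p h.prime (exists_hat h.hind yh hy _) (fun hc => ?_) (fun hc => ?_)
  · exact core1 h hM m (ht _ (by simp [mdeg, Fin.sum_univ_three]; omega) hc)
  · exact coreB h hM m hm2 (ht _ (by simp [mdeg, Fin.sum_univ_three]; omega) hc)

lemma lowhat2 (h : Setup p y u) (m : ℤ) (hm : ¬ (p : ℤ) ∣ m) (hm2 : (p : ℤ) ^ 2 ∣ m ^ p - m)
    (yh : Completion R) (hy : IsRSPhat R yh u) :
    V2 p ⊆ DeltaOf (cmpl (ff p m y u)) yh (fun i => cmpl (u i)) p := by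
  obtain ⟨Y, hM, ht⟩ := nmem_hat u yh hy (p ^ 2 + 2 * p + 10) (by omega) (ff p m y u)
  refine low2 _ _ _ p h.prime (exists_hat h.hind yh hy _) (fun hc => ?_) (fun hc => ?_)
    (fun a b c => ?_)
  · exact core1 h hM m (ht _ (by simp [mdeg, Fin.sum_univ_three]; omega) hc)
  · exact coreA h hM m hm (ht _ (by simp [mdeg, Fin.sum_univ_three]; omega) hc)
  · exact core2 h hM m hm hm2 (ht _ (by simp [mdeg, Fin.sum_univ_three]; omega) a)
      (ht _ (by simp [mdeg, Fin.sum_univ_three]; omega) b)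
      (ht _ (by simp [mdeg, Fin.sum_univ_three]; omega) c)

lemma rsphat_z (h : Setup p y u) (w : R) : IsRSPhat R (cmpl (y - w * p)) u := by
  have e := congrArg (Ideal.map (cmpl (R := R))) (span_z h w)
  rw [Ideal.map_span, Set.image_insert_eq, ← Set.range_comp] at e
  exact e

lemma delta_gen (h : Setup p y u) (m : ℤ) (V : Set (Fin 3 → ℝ)) (hV : V ⊆ orthant 3)
    (T : Set ((Fin 3 → ℕ) × ℕ))
    (hup : ff p m y u ∈ Ideal.span (monomial (y - (m + u 2) * p) u '' T))
    (hproj : ∀ t ∈ T, t.2 < p → projPoint p t ∈ smallestFSubset V)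
    (hlow : V ⊆ DeltaOf (ff p m y u) (y - (m + u 2) * p) u p)
    (hlowhat : ∀ yh, IsRSPhat R yh u →
      V ⊆ DeltaOf (cmpl (ff p m y u)) yh (fun i => cmpl (u i)) p) :
    Delta (ff p m y u) (y - (m + u 2) * p) u = smallestFSubset V ∧
    CharPolyhedron (ff p m y u) u = smallestFSubset V := by
  have hS := isFSubset_smallest hV
  rw [Delta, CharPolyhedron, ordRes_ff h]
  constructor
  · apply le_antisymm
    · exact DeltaOf_subset (h.hind _ (span_z h _)) T hup hS hproj
    · exact smallest_subset (isFSubset_DeltaOf _ _ _ _) hlow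
  · apply le_antisymm
    · refine (Set.iInter₂_subset (cmpl (y - (m + u 2) * p)) (rsphat_z h _)).trans ?_
      refine DeltaOf_subset (indep_hat h.hind _ (rsphat_z h _)) T ?_ hS hproj
      have := Ideal.mem_map_of_mem (cmpl (R := R)) hup
      rw [Ideal.map_span, ← Set.image_comp] at this
      convert this using 3
      exact monomial_map (cmpl (R := R)) _ _ _
    · exact Set.subset_iInter₂ fun yh hy =>
        smallest_subset (isFSubset_DeltaOf _ _ _ _) (hlowhat yh hy)

lemma main1 (h : Setup p y u) (m : ℤ) (hm2 : ¬ (p : ℤ) ^ 2 ∣ m ^ p - m) :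
    Delta (ff p m y u) (y - (m + u 2) * p) u = smallestFSubset (V1 p) ∧
    CharPolyhedron (ff p m y u) u = smallestFSubset (V1 p) := by
  have hM := span_z h (m + u 2)
  refine delta_gen h m _ (V1_orth p) (T1 p) (up1 h.prime m y u h.u0) (proj1 h.prime.two_le)
    ?_ (lowhat1 h m hm2)
  exact low1 _ _ _ p h.prime (exists_expansion_noeth hM (h.hind _ hM)) (core1 h hM m)
    (coreB h hM m hm2)

lemma main2 (h : Setup p y u) (m : ℤ) (hm : ¬ (p : ℤ) ∣ m) (hm2 : (p : ℤ) ^ 2 ∣ m ^ p - m) :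
    Delta (ff p m y u) (y - (m + u 2) * p) u = smallestFSubset (V2 p) ∧
    CharPolyhedron (ff p m y u) u = smallestFSubset (V2 p) := by
  have hM := span_z h (m + u 2)
  refine delta_gen h m _ (V2_orth p h.prime.two_le) (T2 p) (up2 h.prime m hm2 y u h.u0)
    (proj2 h.prime.two_le) ?_ (lowhat2 h m hm hm2)
  exact low2 _ _ _ p h.prime (exists_expansion_noeth hM (h.hind _ hM)) (core1 h hM m)
    (coreA h hM m hm) (core2 h hM m hm hm2)

end fin

lemma wrapper (p : ℕ) (hp : p.Prime) (m : ℤ) (hm : ¬ (p : ℤ) ∣ m) (P : Ideal AA) [P.IsPrime]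
    (R : Type u) [CommRing R] [IsLocalRing R] [IsNoetherianRing R] [Algebra AA R]
    [IsLocalization.AtPrime R P]
    (hP : P = Ideal.span {(p : AA), Polynomial.C (MvPolynomial.X 0),
    Polynomial.C (MvPolynomial.X 1), Polynomial.X})
    (fl zl : R) (ul : Fin 3 → R) (hf : fl = ff p m (yl R) (ull p R))
    (hz : zl = yl R - (m + ull p R 2) * p) (hu : ul = ull p R) :
    IsRSP R zl ul ∧
    (¬ ((p : ℤ) ^ 2 ∣ m ^ p - m) →
      {v | IsVertex (Delta fl zl ul) v} =
        ({![0, 1 / (p : ℝ), 1], ![1 + 1 / (p : ℝ), 0, 0]} : Set (Fin 3 → ℝ))) ∧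
    (((p : ℤ) ^ 2 ∣ m ^ p - m) →
      {v | IsVertex (Delta fl zl ul) v} =
        ({![0, 1 / (p : ℝ), 1], ![1 + 1 / ((p : ℝ) - 1), 0, 0],
          ![1 + 1 / (p : ℝ), 0, 1 / (p : ℝ)]} : Set (Fin 3 → ℝ))) ∧
    Delta fl zl ul = CharPolyhedron fl ul := by
  have h := setup_loc p hp P R hP
  rw [hf, hz, hu]
  refine ⟨⟨?_, ?_⟩, fun hm2 => ?_, fun hm2 => ?_, ?_⟩
  · rw [Fin.range_cons]; exact span_z h _
  · rw [IsLocalization.AtPrime.ringKrullDim_eq_height P R, height_P p hp P hP]; rfl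
  · rw [(main1 h m hm2).1]; exact vertices_case1 p hp.two_le
  · rw [(main2 h m hm hm2).1]; exact vertices_case2 p hp.two_le
  · by_cases hm2 : (p : ℤ) ^ 2 ∣ m ^ p - m
    · rw [(main2 h m hm hm2).1, (main2 h m hm hm2).2]
    · rw [(main1 h m hm2).1, (main1 h m hm2).2]
/-- **Example II.6** (second part). With `z = y - (m + u₃)p` and
`R = A_{(p, u₂, u₃, y)}`, `(z, p, u₂, u₃)` is a r.s.p. of `R`; the vertices of
`Δ(f; p, u₂, u₃; z)` are `{(0, 1/p, 1), (1 + 1/p, 0, 0)}` if `m^p - m ≢ 0 mod p²`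
and `{(0, 1/p, 1), (1 + 1/(p-1), 0, 0), (1 + 1/p, 0, 1/p)}` otherwise; in both
cases `Δ(f; p, u₂, u₃; z) = Δ(f; p, u₂, u₃)`. -/
theorem example_II_6_polyhedron
    (p : ℕ) (hp : p.Prime) (m : ℤ) (hm : ¬ (p : ℤ) ∣ m)
    (u₂ u₃ : MvPolynomial (Fin 2) ℤ)
    (hu₂ : u₂ = MvPolynomial.X 0) (hu₃ : u₃ = MvPolynomial.X 1)
    (f : Polynomial (MvPolynomial (Fin 2) ℤ))
    (hf : f = Polynomial.X ^ p - Polynomial.C (u₂ * u₃ ^ p)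
      - Polynomial.C ((m : MvPolynomial (Fin 2) ℤ) + u₃ ^ p)
          * (p : Polynomial (MvPolynomial (Fin 2) ℤ)) ^ p)
    (z : Polynomial (MvPolynomial (Fin 2) ℤ))
    (hz : z = Polynomial.X - Polynomial.C ((m : MvPolynomial (Fin 2) ℤ) + u₃)
      * (p : Polynomial (MvPolynomial (Fin 2) ℤ)))
    (P : Ideal (Polynomial (MvPolynomial (Fin 2) ℤ)))
    (hP : P = Ideal.span {(p : Polynomial (MvPolynomial (Fin 2) ℤ)),
      Polynomial.C u₂, Polynomial.C u₃, Polynomial.X})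
    [P.IsPrime]
    (fl zl : Localization.AtPrime P)
    (hfl : fl = algebraMap (Polynomial (MvPolynomial (Fin 2) ℤ)) (Localization.AtPrime P) f)
    (hzl : zl = algebraMap (Polynomial (MvPolynomial (Fin 2) ℤ)) (Localization.AtPrime P) z)
    (ul : Fin 3 → Localization.AtPrime P)
    (hul : ul = ![algebraMap (Polynomial (MvPolynomial (Fin 2) ℤ)) (Localization.AtPrime P)
        (p : Polynomial (MvPolynomial (Fin 2) ℤ)),
      algebraMap (Polynomial (MvPolynomial (Fin 2) ℤ)) (Localization.AtPrime P)
        (Polynomial.C u₂),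
      algebraMap (Polynomial (MvPolynomial (Fin 2) ℤ)) (Localization.AtPrime P)
        (Polynomial.C u₃)]) :
    IsRSP (Localization.AtPrime P) zl ul ∧
    (¬ ((p : ℤ) ^ 2 ∣ m ^ p - m) →
      {v | IsVertex (Delta fl zl ul) v} =
        ({![0, 1 / (p : ℝ), 1], ![1 + 1 / (p : ℝ), 0, 0]} : Set (Fin 3 → ℝ))) ∧
    (((p : ℤ) ^ 2 ∣ m ^ p - m) →
      {v | IsVertex (Delta fl zl ul) v} =
        ({![0, 1 / (p : ℝ), 1], ![1 + 1 / ((p : ℝ) - 1), 0, 0],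
          ![1 + 1 / (p : ℝ), 0, 1 / (p : ℝ)]} : Set (Fin 3 → ℝ))) ∧
    Delta fl zl ul = CharPolyhedron fl ul := by
  have hN : IsNoetherianRing (Localization.AtPrime P) :=
    IsLocalization.isNoetherianRing P.primeCompl _ inferInstance
  subst hu₂ hu₃
  refine wrapper p hp m hm P (Localization.AtPrime P) hP fl zl ul ?_ ?_ ?_
  · rw [hfl, hf]
    simp [ff, yl, ull, uu]
  · rw [hzl, hz]
    simp [yl, ull, uu]
  · rw [hul]
    funext i
    fin_cases i <;> simp [ull, uu]

end CharPolyhedra
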